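/- arXiv:2508.00182 — 2 statements merged into one kernel-verified Lean document; each statement's English description precedes it below -/
import Mathlib

section
/- Let (𝐧_i)_{i∈ℕ} ⊆ ℕ^d be a sequence such that: for every j ∈ {1,…,d}, the 2-adic valuation of n_i^j tends to ∞ as i → ∞; and there are k_i ∈ ℕ₀ with 𝐧_i ∈ B_{k_i} and k_i → ∞. Let F := {𝐠 ∈ 𝔾^d : W_{𝐧_i}(𝐠) = 1 for all i ∈ ℕ}. Then there exists λ ∈ [1,2] such that F is a U-set for the d-dimensional Walsh system under λ-convergence; moreover, if 𝐧_i = n_i𝟏 for all i, then F is a U-set under convergence over cubes. -/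
open Filter Finset Topology MeasureTheory
open scoped Classical

noncomputable section

instance : TopologicalSpace (ZMod 2) := ⊥
instance : DiscreteTopology (ZMod 2) := ⟨rfl⟩

/-- The dyadic (Cantor) group `𝔾`: sequences of elements of `ℤ/2ℤ`
with coordinatewise addition modulo 2, Tychonoff topology. -/
abbrev DyadicGroup : Type := ℕ → ZMod 2

instance : MeasurableSpace DyadicGroup := borel _
instance : BorelSpace DyadicGroup := ⟨rfl⟩

/-- `𝔾^d`. -/
abbrev GD (d : ℕ) : Type := Fin d → DyadicGroup

/-- One-dimensional Walsh function `W_n` in the Paley enumeration: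
`W_n(g) = ∏_k (-1)^(g_k n_k)`. -/
def walsh (n : ℕ) (g : DyadicGroup) : ℝ :=
  ∏ k ∈ Finset.range n, if n.testBit k ∧ g k = 1 then (-1 : ℝ) else 1

/-- `d`-dimensional Walsh function `W_𝐧(𝐠) = ∏ W_{n^l}(g^l)`. -/
def walshD {d : ℕ} (n : Fin d → ℕ) (g : GD d) : ℝ :=
  ∏ l, walsh (n l) (g l)

/-- The dyadic interval `Δ^{(k)}_m` of rank `k`. -/
def dyadicInterval (k m : ℕ) : Set DyadicGroup :=
  {g | ∀ t < k, g t = if m.testBit (k - 1 - t) then 1 else 0}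

/-- The dyadic cube `Δ^{(k)}_𝐦 = Δ^{(k)}_{m^1} × ⋯ × Δ^{(k)}_{m^d}`. -/
def dyadicCube {d : ℕ} (k : ℕ) (m : Fin d → ℕ) : Set (GD d) :=
  {g | ∀ l, g l ∈ dyadicInterval k (m l)}

/-- The canonical point of `Δ^{(k)}_m`. -/
def intervalPoint (k m : ℕ) : DyadicGroup :=
  fun t => if t < k ∧ m.testBit (k - 1 - t) then 1 else 0

/-- The canonical point of `Δ^{(k)}_𝐦`. -/
def cubePoint {d : ℕ} (k : ℕ) (m : Fin d → ℕ) : GD d :=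
  fun l => intervalPoint k (m l)

/-- `W^{(k)}_{n,m}`: the (constant, for `n < 2^k`) value of `W_n` on `Δ^{(k)}_m`. -/
def walshVal (k n m : ℕ) : ℝ := walsh n (intervalPoint k m)

/-- `W^{(k)}_{𝐧𝐦}`: the (constant, for `𝐧 < 2^k·𝟏`) value of `W_𝐧` on `Δ^{(k)}_𝐦`. -/
def walshValD {d : ℕ} (k : ℕ) (n m : Fin d → ℕ) : ℝ := walshD n (cubePoint k m)

/-- The box `{𝐧 : 𝐧 < 𝐍}` as a finset. -/
def boxLt {d : ℕ} (N : Fin d → ℕ) : Finset (Fin d → ℕ) :=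
  Fintype.piFinset fun l => Finset.range (N l)

/-- The box `{0,…,2^k−1}^d` as a set. -/
def box (d k : ℕ) : Set (Fin d → ℕ) := {m | ∀ l, m l < 2 ^ k}

/-- The rectangular partial sum `S_𝐍(𝐠)` of the Walsh series with coefficients `a`. -/
def walshPartialSum {d : ℕ} (a : (Fin d → ℕ) → ℂ) (N : Fin d → ℕ) (g : GD d) : ℂ :=
  ∑ n ∈ boxLt N, a n * (walshD n g : ℂ)

/-- Convergence over rectangles: `S_𝐍(𝐠) → S` as `min_j N^j → ∞`. -/
def ConvergesOverRectangles {d : ℕ} (a : (Fin d → ℕ) → ℂ) (g : GD d) (S : ℂ) : Prop :=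
  Tendsto (fun N : Fin d → ℕ => walshPartialSum a N g) atTop (𝓝 S)

/-- Convergence over cubes: `S_{N𝟏}(𝐠) → S` as `N → ∞`. -/
def ConvergesOverCubes {d : ℕ} (a : (Fin d → ℕ) → ℂ) (g : GD d) (S : ℂ) : Prop :=
  Tendsto (fun N : ℕ => walshPartialSum a (fun _ => N) g) atTop (𝓝 S)

/-- `λ`-convergence: `S_𝐍(𝐠) → S` as `min_j N^j → ∞` along `𝐍` with `max N^j/N^k ≤ λ`. -/
def LambdaConverges {d : ℕ} (lam : ℝ) (a : (Fin d → ℕ) → ℂ) (g : GD d) (S : ℂ) : Prop :=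
  ∀ ε : ℝ, 0 < ε → ∃ K : ℕ, ∀ N : Fin d → ℕ, (∀ j, K ≤ N j) →
    (∀ j k, (N j : ℝ) ≤ lam * N k) → ‖walshPartialSum a N g - S‖ < ε

/-- Auxiliary predicate for iterated summation of a multiple series with terms `f`;
the list gives the order of summation, *innermost index first*.  After summing the
series in the variables of the list, the remaining (partially summed) function is `g`. -/
def IterConvAux {d : ℕ} : List (Fin d) → ((Fin d → ℕ) → ℂ) → ((Fin d → ℕ) → ℂ) → Prop
  | [], f, g => f = g
  | j :: rest, f, g => ∃ h : (Fin d → ℕ) → ℂ,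
      (∀ n, Tendsto (fun T : ℕ => ∑ t ∈ Finset.range T, f (Function.update n j t))
        atTop (𝓝 (h n))) ∧ IterConvAux rest h g

/-- The multiple series with terms `f` converges iteratedly to `S`, the order of
summation being given by the list `l` (innermost index first): all successively
nested inner series converge and the full iterated sum equals `S`. -/
def IterConverges {d : ℕ} (l : List (Fin d)) (f : (Fin d → ℕ) → ℂ) (S : ℂ) : Prop :=
  ∃ g, IterConvAux l f g ∧ ∀ n, g n = S

/-- `A` is an M-set for the `d`-dimensional Walsh system under rectangular convergence. -/
def IsMSetRect {d : ℕ} (A : Set (GD d)) : Prop :=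
  ∃ a : (Fin d → ℕ) → ℂ, (∃ n, a n ≠ 0) ∧ ∀ g ∉ A, ConvergesOverRectangles a g 0

/-- `A` is an M-set for the `d`-dimensional Walsh system under convergence over cubes. -/
def IsMSetCubes {d : ℕ} (A : Set (GD d)) : Prop :=
  ∃ a : (Fin d → ℕ) → ℂ, (∃ n, a n ≠ 0) ∧ ∀ g ∉ A, ConvergesOverCubes a g 0

/-- `A` is an M-set under iterated convergence with summation order `l` (innermost first). -/
def IsMSetIter {d : ℕ} (A : Set (GD d)) (l : List (Fin d)) : Prop :=
  ∃ a : (Fin d → ℕ) → ℂ, (∃ n, a n ≠ 0) ∧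
    ∀ g ∉ A, IterConverges l (fun n => a n * (walshD n g : ℂ)) 0

/-- `A` is an M-set for the `d`-dimensional Walsh system under `λ`-convergence. -/
def IsMSetLambda {d : ℕ} (lam : ℝ) (A : Set (GD d)) : Prop :=
  ∃ a : (Fin d → ℕ) → ℂ, (∃ n, a n ≠ 0) ∧ ∀ g ∉ A, LambdaConverges lam a g 0

/-- A quasimeasure: a finitely additive function on dyadic cubes (indexed by rank
`k` and position `𝐦 < 2^k·𝟏`). -/
def IsQuasimeasure {d : ℕ} (τ : ℕ → (Fin d → ℕ) → ℂ) : Prop :=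
  ∀ k m, (∀ l, m l < 2 ^ k) →
    τ k m = ∑ σ : Fin d → Fin 2, τ (k + 1) fun l => 2 * m l + (σ l : ℕ)

/-- The quasimeasure generated by the Walsh series with coefficients `a`:
`τ(Δ^{(k)}_𝐦) = 2^{-kd} ∑_{𝐧<2^k𝟏} a_𝐧 W_𝐧(Δ^{(k)}_𝐦)`. -/
def genQM {d : ℕ} (a : (Fin d → ℕ) → ℂ) (k : ℕ) (m : Fin d → ℕ) : ℂ :=
  ((2 : ℂ) ^ (k * d))⁻¹ * ∑ n ∈ boxLt (fun _ : Fin d => 2 ^ k), a n * (walshValD k n m : ℂ)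

/-- The Fourier–Walsh coefficient `τ̂_𝐧` of a quasimeasure `τ`, computed at resolution `k`
(the value does not depend on `k` as long as `𝐧 < 2^k𝟏`). -/
def fourierCoeffAt {d : ℕ} (τ : ℕ → (Fin d → ℕ) → ℂ) (n : Fin d → ℕ) (k : ℕ) : ℂ :=
  ∑ m ∈ boxLt (fun _ : Fin d => 2 ^ k), (walshValD k n m : ℂ) * τ k m

/-- The local Fourier–Walsh coefficient `τ̂_𝐧(Δ^{(r)}_{𝐦Δ})`, computed at resolution `k ≥ r`. -/
def localCoeffAt {d : ℕ} (τ : ℕ → (Fin d → ℕ) → ℂ) (n : Fin d → ℕ)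
    (r : ℕ) (mΔ : Fin d → ℕ) (k : ℕ) : ℂ :=
  ∑ m ∈ (boxLt (fun _ : Fin d => 2 ^ k)).filter
      (fun m => dyadicCube k m ⊆ dyadicCube r mΔ),
    (walshValD k n m : ℂ) * τ k m

/-- The support of a quasimeasure: the complement of the union of all dyadic cubes `Δ₀`
such that `τ(Δ) = 0` for every dyadic cube `Δ ⊆ Δ₀`. -/
def qmSupport {d : ℕ} (τ : ℕ → (Fin d → ℕ) → ℂ) : Set (GD d) :=
  (⋃ k, ⋃ m ∈ box d k,
    ⋃ (_ : ∀ k' m', (∀ l, m' l < 2 ^ k') →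
        dyadicCube k' m' ⊆ dyadicCube k m → τ k' m' = 0),
    dyadicCube k m)ᶜ

/-- The restriction `τ|_{Δ̃}` of a quasimeasure to the dyadic cube `Δ̃ = Δ^{(r)}_{𝐦Δ}`:
`τ|_{Δ̃}(Δ) = τ(Δ̃ ∩ Δ)` (two dyadic cubes are nested or disjoint). -/
def restrictQM {d : ℕ} (τ : ℕ → (Fin d → ℕ) → ℂ) (r : ℕ) (mΔ : Fin d → ℕ) :
    ℕ → (Fin d → ℕ) → ℂ := fun k m =>
  if dyadicCube k m ⊆ dyadicCube (d := d) r mΔ then τ k m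
  else if dyadicCube (d := d) r mΔ ⊆ dyadicCube k m then τ r mΔ
  else 0

/-- `τ` is the canonical quasimeasure `τ_E` associated with a (nonempty closed) set `E`:
`τ(𝔾^d) = 1`; `τ(Δ) = 0` iff `Δ ∩ E = ∅`; and the mass of a cube meeting `E` is divided
equally among its `2^d` immediate subcubes that meet `E`. -/
def IsTauOf {d : ℕ} (E : Set (GD d)) (τ : ℕ → (Fin d → ℕ) → ℂ) : Prop :=
  IsQuasimeasure τ ∧
  τ 0 (fun _ => 0) = 1 ∧
  (∀ k m, (∀ l, m l < 2 ^ k) → (τ k m = 0 ↔ dyadicCube k m ∩ E = ∅)) ∧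
  (∀ k m, (∀ l, m l < 2 ^ k) → (dyadicCube k m ∩ E).Nonempty →
    ∀ σ : Fin d → Fin 2,
      τ (k + 1) (fun l => 2 * m l + (σ l : ℕ)) =
        if (dyadicCube (k + 1) (fun l => 2 * m l + (σ l : ℕ)) ∩ E).Nonempty then
          τ k m / ((Finset.univ.filter fun σ' : Fin d → Fin 2 =>
              (dyadicCube (k + 1) (fun l => 2 * m l + (σ' l : ℕ)) ∩ E).Nonempty).card : ℂ)
        else 0)

/-- The sequence `m_s`: `m_1 = 0`, `m_{s+1} = 2(2m_s+1)` (value at `0` is junk). -/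
def mSeq : ℕ → ℕ
  | 0 => 0
  | s + 1 => if s = 0 then 0 else 2 * (2 * mSeq s + 1)

/-- The layer `F_s^π`. -/
def Fspi {d : ℕ} (π : ℕ → (Fin d → ℕ) → Fin d → ℕ) (s : ℕ) : Set (GD d) :=
  ⋃ m ∈ box d (mSeq s), ⋃ m' ∈ box d (mSeq s),
    {g | g ∈ dyadicCube (2 * mSeq s) (fun l => 2 ^ mSeq s * m l + m' l) ∧
      walshD (fun _ => 2 ^ (2 * mSeq s)) g = walshValD (mSeq s) (π s m) m'}

/-- `F̃_s^π = F_1^π ∩ ⋯ ∩ F_s^π` (so `F̃_0^π = 𝔾^d`). -/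
def Ftil {d : ℕ} (π : ℕ → (Fin d → ℕ) → Fin d → ℕ) (s : ℕ) : Set (GD d) :=
  ⋂ k ∈ Finset.Icc 1 s, Fspi π k

/-- `F^π = ⋂_{s≥1} F_s^π`. -/
def Fpi {d : ℕ} (π : ℕ → (Fin d → ℕ) → Fin d → ℕ) : Set (GD d) :=
  ⋂ s ∈ Set.Ici 1, Fspi π s

/-- The identity element of `S` (yielding `F_s`, `F̃_s` and `F` themselves). -/
def idPerm (d : ℕ) : ℕ → (Fin d → ℕ) → Fin d → ℕ := fun _ m => m

/-- `S`: sequences `π = (π_s)` of permutations of the boxes `{0,…,2^{m_s}−1}^d`. -/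
structure PermSeq (d : ℕ) where
  p : ℕ → Equiv.Perm (Fin d → ℕ)
  maps : ∀ s, Set.MapsTo (p s) (box d (mSeq s)) (box d (mSeq s))

/-- The underlying sequence of functions of an element of `S`. -/
def PermSeq.f {d : ℕ} (π : PermSeq d) : ℕ → (Fin d → ℕ) → Fin d → ℕ := fun s => ⇑(π.p s)

/-- `π ∈ S'`: every `π_s` acts coordinatewise, `π_s(𝐦) = (π_s^1(m^1),…,π_s^d(m^d))`. -/
def PermSeq.Coordinatewise {d : ℕ} (π : PermSeq d) : Prop :=
  ∀ s, ∃ e : Fin d → ℕ → ℕ, ∀ m : Fin d → ℕ, π.p s m = fun l => e l (m l)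

/-- The Dirichlet kernel `D_N = ∑_{n<N} W_n` of the one-dimensional Walsh system. -/
def dirichlet (N : ℕ) (g : DyadicGroup) : ℝ :=
  ∑ n ∈ Finset.range N, walsh n g

namespace WalshU

variable {d : ℕ}

lemma walsh_eq (n K : ℕ) (hK : ∀ k, n.testBit k = true → k < K) (g : DyadicGroup) :
    walsh n g = ∏ k ∈ Finset.range K, if n.testBit k ∧ g k = 1 then (-1 : ℝ) else 1 := by
  have key : ∀ A B : ℕ, A ≤ B → (∀ k, n.testBit k = true → k < A) →
      (∏ k ∈ Finset.range A, if n.testBit k ∧ g k = 1 then (-1 : ℝ) else 1) =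
      ∏ k ∈ Finset.range B, if n.testBit k ∧ g k = 1 then (-1 : ℝ) else 1 := by
    intro A B hAB hA
    apply Finset.prod_subset (by simpa using hAB)
    intro x _ hx
    rw [if_neg]
    rintro ⟨h, _⟩
    exact hx (by simpa using hA x h)
  have hn : ∀ k, n.testBit k = true → k < n := fun k hk =>
    lt_of_lt_of_le Nat.lt_two_pow_self (Nat.ge_two_pow_of_testBit hk)
  unfold walsh
  rcases le_total n K with h | h
  · exact key _ _ h hn
  · exact (key _ _ h hK).symm

lemma walsh_add (n : ℕ) (g h : DyadicGroup) : walsh n (g + h) = walsh n g * walsh n h := by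
  unfold walsh
  rw [← Finset.prod_mul_distrib]
  refine Finset.prod_congr rfl fun k _ => ?_
  cases hb : n.testBit k
  · simp
  · have : ∀ a b : ZMod 2, (if a + b = 1 then (-1 : ℝ) else 1) =
        (if a = 1 then (-1 : ℝ) else 1) * (if b = 1 then (-1 : ℝ) else 1) := by
      intro a b
      have h1 : (1 : ZMod 2) + 1 = 0 := by decide
      have h2 : ∀ z : ZMod 2, z = 0 ∨ z = 1 := by decide
      rcases h2 a with rfl | rfl <;> rcases h2 b with rfl | rfl <;> simp [h1]
    simpa using this (g k) (h k)

lemma walsh_zero (n : ℕ) : walsh n 0 = 1 := by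
  simp [walsh]

lemma walsh_xor (n m : ℕ) (g : DyadicGroup) : walsh (n ^^^ m) g = walsh n g * walsh m g := by
  have hb : ∀ (p k : ℕ), p ≤ n + m + (n ^^^ m) → p.testBit k = true → k < n + m + (n ^^^ m) :=
    fun p k hp hk => lt_of_lt_of_le
      (lt_of_lt_of_le Nat.lt_two_pow_self (Nat.ge_two_pow_of_testBit hk)) hp
  rw [walsh_eq n _ (fun k => hb n k (by omega)), walsh_eq m _ (fun k => hb m k (by omega)),
    walsh_eq (n ^^^ m) _ (fun k => hb _ k (by omega)), ← Finset.prod_mul_distrib]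
  refine Finset.prod_congr rfl fun k _ => ?_
  rw [Nat.testBit_xor]
  cases n.testBit k <;> cases m.testBit k <;> by_cases h : g k = 1 <;> simp [h]

lemma walsh_single (n t : ℕ) :
    walsh n (Pi.single t 1) = if n.testBit t then (-1 : ℝ) else 1 := by
  rw [walsh_eq n (n + t + 1) (fun k hk => by
    have := lt_of_lt_of_le Nat.lt_two_pow_self (Nat.ge_two_pow_of_testBit hk)
    omega)]
  rw [Finset.prod_eq_single t]
  · simp
  · intro b _ hb
    simp [Pi.single_apply, hb]
  · intro h
    exact absurd (Finset.mem_range.2 (by omega)) h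

lemma walsh_sq (n : ℕ) (g : DyadicGroup) : walsh n g * walsh n g = 1 := by
  unfold walsh
  rw [← Finset.prod_mul_distrib]
  apply Finset.prod_eq_one
  intro k _
  split_ifs <;> norm_num

lemma walsh_congr (n k : ℕ) (hn : n < 2 ^ k) (g h : DyadicGroup) (hg : ∀ t < k, g t = h t) :
    walsh n g = walsh n h := by
  have hb : ∀ t, n.testBit t = true → t < k := fun t ht => by
    have h1 := lt_of_le_of_lt (Nat.ge_two_pow_of_testBit ht) hn
    exact (Nat.pow_lt_pow_iff_right (by norm_num)).1 h1
  rw [walsh_eq n k hb, walsh_eq n k hb]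
  refine Finset.prod_congr rfl fun t ht => ?_
  rw [hg t (by simpa using ht)]

lemma walshD_add (n : Fin d → ℕ) (g h : GD d) : walshD n (g + h) = walshD n g * walshD n h := by
  unfold walshD
  rw [← Finset.prod_mul_distrib]
  exact Finset.prod_congr rfl fun l _ => walsh_add _ _ _

lemma walshD_zero (n : Fin d → ℕ) : walshD n 0 = 1 := by
  simp [walshD, walsh_zero]

lemma walshD_sq (n : Fin d → ℕ) (g : GD d) : walshD n g * walshD n g = 1 := by
  unfold walshD
  rw [← Finset.prod_mul_distrib]
  exact Finset.prod_eq_one fun l _ => walsh_sq _ _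

lemma walshD_abs (n : Fin d → ℕ) (g : GD d) : |walshD n g| = 1 := by
  have h := walshD_sq n g
  rcases mul_self_eq_one_iff.1 h with h | h <;> simp [h]

lemma walshD_norm (n : Fin d → ℕ) (g : GD d) : ‖(walshD n g : ℂ)‖ = 1 := by
  rw [Complex.norm_real, Real.norm_eq_abs, walshD_abs]

lemma walshD_xor (n m : Fin d → ℕ) (g : GD d) :
    walshD (fun l => n l ^^^ m l) g = walshD n g * walshD m g := by
  unfold walshD
  rw [← Finset.prod_mul_distrib]
  exact Finset.prod_congr rfl fun l _ => walsh_xor _ _ _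

/-- agreement on the first `k` bits -/
def agree (k : ℕ) (g h : GD d) : Prop := ∀ l, ∀ t < k, g l t = h l t

lemma walshD_congr (n : Fin d → ℕ) (k : ℕ) (hn : ∀ l, n l < 2 ^ k) (g h : GD d)
    (hg : agree k g h) : walshD n g = walshD n h :=
  Finset.prod_congr rfl fun l _ => walsh_congr _ k (hn l) _ _ (hg l)

/-- unit vector -/
def unitv (x : Fin d × ℕ) : GD d := Pi.single x.1 (Pi.single x.2 1)

/-- point with given set of ones -/
def pt (s : Finset (Fin d × ℕ)) : GD d := ∑ x ∈ s, unitv x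

/-- sign -/
def chi (n : Fin d → ℕ) (x : Fin d × ℕ) : ℝ := if (n x.1).testBit x.2 then -1 else 1

lemma walshD_unitv (n : Fin d → ℕ) (x : Fin d × ℕ) : walshD n (unitv x) = chi n x := by
  unfold walshD unitv chi
  rw [Finset.prod_eq_single x.1]
  · rw [Pi.single_eq_same, walsh_single]
  · intro b _ hb
    rw [Pi.single_eq_of_ne hb, walsh_zero]
  · simp

lemma walshD_pt (n : Fin d → ℕ) (s : Finset (Fin d × ℕ)) :
    walshD n (pt s) = ∏ x ∈ s, chi n x := by
  induction s using Finset.induction_on with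
  | empty => simp [pt, walshD_zero]
  | insert x s hx ih =>
    rw [Finset.prod_insert hx, ← ih, pt, Finset.sum_insert hx, walshD_add, walshD_unitv, pt]

lemma pt_apply (s : Finset (Fin d × ℕ)) (l : Fin d) (t : ℕ) (h : (l, t) ∉ s) :
    pt s l t = 0 := by
  unfold pt
  rw [Finset.sum_apply, Finset.sum_apply]
  apply Finset.sum_eq_zero
  intro x hx
  unfold unitv
  by_cases h1 : l = x.1
  · subst h1
    rw [Pi.single_eq_same, Pi.single_eq_of_ne]
    rintro rfl
    exact h hx
  · rw [Pi.single_eq_of_ne h1]; rfl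

lemma agree_pt (k : ℕ) (g : GD d) (s : Finset (Fin d × ℕ)) (hs : ∀ x ∈ s, k ≤ x.2) :
    agree k g (g + pt s) := by
  intro l t ht
  have : pt s l t = 0 := pt_apply s l t fun h => by
    have := hs _ h
    simp at this
    omega
  simp [this]

lemma orth (n m : Fin d → ℕ) (T : Finset (Fin d × ℕ)) :
    ∑ s ∈ T.powerset, walshD m (pt s) * walshD n (pt s) =
      if ∀ x ∈ T, (n x.1).testBit x.2 = (m x.1).testBit x.2 then (2 : ℝ) ^ T.card else 0 := by
  have h1 : ∀ s ∈ T.powerset, walshD m (pt s) * walshD n (pt s) =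
      ∏ x ∈ s, (chi m x * chi n x) := by
    intro s _
    rw [walshD_pt, walshD_pt, Finset.prod_mul_distrib]
  rw [Finset.sum_congr rfl h1, ← Finset.prod_one_add]
  split_ifs with h
  · rw [← Finset.prod_const]
    refine Finset.prod_congr rfl fun x hx => ?_
    have := h x hx
    unfold chi
    rw [this]
    split_ifs <;> norm_num
  · push Not at h
    obtain ⟨x, hx, hne⟩ := h
    apply Finset.prod_eq_zero hx
    unfold chi
    cases h1 : (n x.1).testBit x.2 <;> cases h2 : (m x.1).testBit x.2 <;> simp_all

lemma avg (a : (Fin d → ℕ) → ℂ) (B : Finset (Fin d → ℕ)) (m : Fin d → ℕ)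
    (T : Finset (Fin d × ℕ)) (g : GD d) :
    ∑ s ∈ T.powerset, (walshD m (g + pt s) : ℂ) * ∑ n ∈ B, a n * (walshD n (g + pt s) : ℂ) =
    (2 : ℂ) ^ T.card * ∑ n ∈ B.filter
      (fun n => ∀ x ∈ T, (n x.1).testBit x.2 = (m x.1).testBit x.2),
        a n * ((walshD n g : ℂ) * (walshD m g : ℂ)) := by
  simp_rw [Finset.mul_sum]
  rw [Finset.sum_comm, Finset.sum_filter]
  refine Finset.sum_congr rfl fun n _ => ?_
  have h := congrArg (fun r : ℝ => (r : ℂ)) (orth n m T)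
  simp only [Complex.ofReal_sum, Complex.ofReal_mul] at h
  have h2 : ∀ s ∈ T.powerset, (walshD m (g + pt s) : ℂ) * (a n * (walshD n (g + pt s) : ℂ)) =
      (a n * ((walshD n g : ℂ) * (walshD m g : ℂ))) *
        ((walshD m (pt s) : ℂ) * (walshD n (pt s) : ℂ)) := by
    intro s _
    rw [walshD_add, walshD_add]
    push_cast
    ring
  rw [Finset.sum_congr rfl h2, ← Finset.mul_sum, h]
  split_ifs <;> push_cast <;> ring

lemma mem_boxLt (N n : Fin d → ℕ) : n ∈ boxLt N ↔ ∀ l, n l < N l := by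
  simp [boxLt]

/-- dyadic cubic partial sum -/
def P (a : (Fin d → ℕ) → ℂ) (k : ℕ) (g : GD d) : ℂ := walshPartialSum a (fun _ => 2 ^ k) g

lemma P_congr (a : (Fin d → ℕ) → ℂ) (k : ℕ) (g h : GD d) (hg : agree k g h) :
    P a k g = P a k h := by
  unfold P walshPartialSum
  refine Finset.sum_congr rfl fun n hn => ?_
  rw [walshD_congr n k ((mem_boxLt _ _).1 hn) g h hg]

lemma lt_of_bit (n k : ℕ) (hn : n < 2 ^ (k + 1)) (hb : n.testBit k = false) : n < 2 ^ k := by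
  apply Nat.lt_pow_two_of_testBit
  intro i hi
  rcases hi.lt_or_eq with h | h
  · exact Nat.testBit_lt_two_pow (lt_of_lt_of_le hn (Nat.pow_le_pow_right (by norm_num) h))
  · rw [← h]; exact hb

lemma P_step (a : (Fin d → ℕ) → ℂ) (k : ℕ) (g : GD d) :
    ∃ g', agree k g g' ∧ ‖P a k g‖ ≤ ‖P a (k + 1) g'‖ := by
  by_contra hcon
  push Not at hcon
  set T : Finset (Fin d × ℕ) := Finset.univ ×ˢ {k} with hT
  have hmem : ∀ x ∈ T, x.2 = k := by
    intro x hx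
    exact Finset.mem_singleton.1 (Finset.mem_product.1 hx).2
  have h := avg a (boxLt (fun _ => 2 ^ (k + 1))) 0 T g
  have h0 : ∀ g : GD d, walshD (0 : Fin d → ℕ) g = 1 := by
    intro g
    simp [walshD, walsh]
  have hf : (boxLt (fun _ : Fin d => 2 ^ (k + 1))).filter
      (fun n => ∀ x ∈ T, (n x.1).testBit x.2 = ((0 : Fin d → ℕ) x.1).testBit x.2) =
      boxLt (fun _ => 2 ^ k) := by
    ext n
    rw [Finset.mem_filter, mem_boxLt, mem_boxLt]
    constructor
    · rintro ⟨h1, h2⟩ l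
      exact lt_of_bit _ _ (h1 l) (by simpa using h2 (l, k) (by simp [hT]))
    · intro h1
      refine ⟨fun l => (h1 l).trans (Nat.pow_lt_pow_right (by norm_num) (by omega)), ?_⟩
      intro x hx
      rw [hmem x hx]
      simpa using Nat.testBit_lt_two_pow (h1 x.1)
  rw [hf] at h
  simp only [h0, Complex.ofReal_one, one_mul, mul_one] at h
  have h' : ∑ s ∈ T.powerset, P a (k + 1) (g + pt s) = (2 : ℂ) ^ T.card * P a k g := h
  have hlt : ‖∑ s ∈ T.powerset, P a (k + 1) (g + pt s)‖ < ∑ s ∈ T.powerset, ‖P a k g‖ := by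
    refine lt_of_le_of_lt (norm_sum_le _ _) (Finset.sum_lt_sum_of_nonempty ⟨∅, by simp⟩ ?_)
    intro s hs
    refine hcon _ (agree_pt k g s fun x hx => ?_)
    exact (hmem x (Finset.mem_powerset.1 hs hx)).ge
  rw [h', norm_mul, Finset.sum_const, Finset.card_powerset] at hlt
  simp at hlt

lemma P_zero (a : (Fin d → ℕ) → ℂ) (k : ℕ) (g : GD d)
    (hg : ∀ g', agree k g g' → Tendsto (fun j => P a j g') atTop (𝓝 0)) : P a k g = 0 := by
  choose f hf1 hf2 using P_step a
  let G : ℕ → GD d := fun j => Nat.rec g (fun j h => f (k + j) h) j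
  have hG0 : G 0 = g := rfl
  have hGs : ∀ j, G (j + 1) = f (k + j) (G j) := fun j => rfl
  have hle : ∀ i j, i ≤ j → agree (k + i) (G i) (G j) := by
    intro i j hij
    induction j, hij using Nat.le_induction with
    | base => intro l t _; rfl
    | succ j hj ih =>
      intro l t ht
      rw [ih l t ht, hGs]
      exact hf1 (k + j) (G j) l t (by omega)
  let g' : GD d := fun l t => G (t + 1) l t
  have hag : ∀ j, agree (k + j) (G j) g' := by
    intro j l t ht
    show G j l t = G (t + 1) l t
    rcases le_total j (t + 1) with h | h
    · exact hle j (t + 1) h l t ht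
    · exact (hle (t + 1) j h l t (by omega)).symm
  have hn : ∀ j, ‖P a k g‖ ≤ ‖P a (k + j) (G j)‖ := by
    intro j
    induction j with
    | zero => exact le_rfl
    | succ j ih =>
      refine ih.trans ?_
      rw [hGs]
      exact hf2 (k + j) (G j)
  have ht := (hg g' (hag 0)).norm
  have ht2 := ht.comp (tendsto_add_atTop_nat k)
  have : ‖P a k g‖ ≤ ‖(0 : ℂ)‖ := by
    refine ge_of_tendsto' ht2 fun j => ?_
    show _ ≤ ‖P a (j + k) g'‖
    rw [add_comm, ← P_congr a (k + j) _ _ (hag j)]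
    exact hn j
  simpa using this

lemma extract (a : (Fin d → ℕ) → ℂ) (k : ℕ) (m : Fin d → ℕ) (hm : ∀ l, m l < 2 ^ k) :
    ∑ s ∈ (Finset.univ ×ˢ Finset.range k : Finset (Fin d × ℕ)).powerset,
      (walshD m (pt s) : ℂ) * P a k (pt s) =
    (2 : ℂ) ^ (Finset.univ ×ˢ Finset.range k : Finset (Fin d × ℕ)).card * a m := by
  obtain ⟨T, hT⟩ : ∃ T : Finset (Fin d × ℕ), T = Finset.univ ×ˢ Finset.range k := ⟨_, rfl⟩
  rw [← hT]
  have h := avg a (boxLt (fun _ => 2 ^ k)) m T 0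
  have hf : (boxLt (fun _ : Fin d => 2 ^ k)).filter
      (fun n => ∀ x ∈ T,
        (n x.1).testBit x.2 = (m x.1).testBit x.2) = {m} := by
    ext n
    rw [Finset.mem_filter, mem_boxLt, Finset.mem_singleton]
    constructor
    · rintro ⟨h1, h2⟩
      funext l
      apply Nat.eq_of_testBit_eq
      intro t
      by_cases ht : t < k
      · exact h2 (l, t) (by simpa [hT] using ht)
      · have hk : (2 : ℕ) ^ k ≤ 2 ^ t := Nat.pow_le_pow_right (by norm_num) (by omega)
        rw [Nat.testBit_lt_two_pow (lt_of_lt_of_le (h1 l) hk),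
          Nat.testBit_lt_two_pow (lt_of_lt_of_le (hm l) hk)]
    · rintro rfl
      exact ⟨hm, fun _ _ => rfl⟩
  rw [hf, Finset.sum_singleton] at h
  simp only [zero_add, walshD_zero, Complex.ofReal_one, mul_one] at h
  exact h

/-- The set `F`. -/
def Fset (nseq : ℕ → Fin d → ℕ) : Set (GD d) := {g : GD d | ∀ i, walshD (nseq i) g = 1}

lemma shift_inv (a : (Fin d → ℕ) → ℂ) (nseq : ℕ → Fin d → ℕ)
    (hconv : ∀ g ∉ Fset nseq, Tendsto (fun j => P a j g) atTop (𝓝 0))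
    (i : ℕ) (m : Fin d → ℕ) : a (fun l => m l ^^^ nseq i l) = a m := by
  obtain ⟨k, hk1, hk2⟩ : ∃ k, (∀ l, m l < 2 ^ k) ∧ ∀ l, nseq i l < 2 ^ k := by
    refine ⟨∑ l, (m l + nseq i l), fun l => ?_, fun l => ?_⟩ <;>
    · refine lt_of_le_of_lt ?_ Nat.lt_two_pow_self
      have := Finset.single_le_sum (f := fun l => m l + nseq i l)
        (fun _ _ => Nat.zero_le _) (Finset.mem_univ l)
      omega
  have hP : ∀ g, (walshD (nseq i) g : ℂ) * P a k g = P a k g := by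
    intro g
    by_cases h : walshD (nseq i) g = 1
    · simp [h]
    · rw [P_zero a k g]
      · simp
      · intro g' hg'
        apply hconv
        intro hF
        apply h
        rw [walshD_congr _ k hk2 g g' hg']
        exact hF i
  have e1 := extract a k m hk1
  have e2 := extract a k (fun l => m l ^^^ nseq i l)
    (fun l => Nat.xor_lt_two_pow (hk1 l) (hk2 l))
  have : ∀ s ∈ (Finset.univ ×ˢ Finset.range k : Finset (Fin d × ℕ)).powerset,
      (walshD (fun l => m l ^^^ nseq i l) (pt s) : ℂ) * P a k (pt s) =
      (walshD m (pt s) : ℂ) * P a k (pt s) := by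
    intro s _
    rw [walshD_xor]
    push_cast
    rw [mul_assoc, hP]
  rw [Finset.sum_congr rfl this, e1] at e2
  exact (mul_left_cancel₀ (pow_ne_zero _ two_ne_zero) e2).symm

lemma F_nowhere (hd : 2 ≤ d) (nseq : ℕ → Fin d → ℕ) (kseq : ℕ → ℕ)
    (hblock : ∀ i j, 2 ^ kseq i ≤ nseq i j ∧ nseq i j < 2 ^ (kseq i + 1))
    (hktop : Tendsto kseq atTop atTop) (k : ℕ) (g : GD d) :
    ∃ g', agree k g g' ∧ g' ∉ Fset nseq := by
  obtain ⟨i, hi⟩ := (hktop.eventually_ge_atTop k).exists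
  by_cases h : g ∈ Fset nseq
  · refine ⟨g + pt {(⟨0, by omega⟩, kseq i)}, agree_pt k g _ (by simpa using hi), fun h2 => ?_⟩
    have h3 := h2 i
    rw [walshD_add, h i, walshD_pt, Finset.prod_singleton] at h3
    have hb : (nseq i ⟨0, by omega⟩).testBit (kseq i) = true := by
      by_contra hb
      have := lt_of_bit _ _ (hblock i ⟨0, by omega⟩).2 (by simpa using hb)
      have := (hblock i ⟨0, by omega⟩).1
      omega
    simp [chi, hb] at h3
    norm_num at h3
  · exact ⟨g, fun _ _ _ => rfl, h⟩

lemma mixed (a : (Fin d → ℕ) → ℂ) (n : Fin d → ℕ) (g : GD d) :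
    ∑ t ∈ (Finset.univ : Finset (Fin d)).powerset, (-1 : ℂ) ^ (Finset.univ \ t).card *
      walshPartialSum a (fun l => if l ∈ t then n l + 1 else n l) g = a n * (walshD n g : ℂ) := by
  have h1 : ∀ t ∈ (Finset.univ : Finset (Fin d)).powerset,
      walshPartialSum a (fun l => if l ∈ t then n l + 1 else n l) g =
      ∑ p ∈ boxLt (fun l => n l + 1), a p * (walshD p g : ℂ) *
        if ∀ l, p l < (if l ∈ t then n l + 1 else n l) then 1 else 0 := by
    intro t _
    unfold walshPartialSum
    simp_rw [mul_ite, mul_one, mul_zero]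
    rw [← Finset.sum_filter]
    refine Finset.sum_congr ?_ fun _ _ => rfl
    ext p
    rw [Finset.mem_filter, mem_boxLt, mem_boxLt]
    constructor
    · intro h
      refine ⟨fun l => ?_, h⟩
      have := h l
      split_ifs at this <;> omega
    · exact fun h => h.2
  rw [Finset.sum_congr rfl fun t ht => by rw [h1 t ht, Finset.mul_sum], Finset.sum_comm]
  have h2 : ∀ p ∈ boxLt (fun l => n l + 1),
      ∑ t ∈ (Finset.univ : Finset (Fin d)).powerset, (-1 : ℂ) ^ (Finset.univ \ t).card *
        (a p * (walshD p g : ℂ) *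
          if ∀ l, p l < (if l ∈ t then n l + 1 else n l) then 1 else 0) =
      if p = n then a n * (walshD n g : ℂ) else 0 := by
    intro p hp
    have h3 := Finset.prod_add (fun l => if p l < n l + 1 then (1 : ℂ) else 0)
      (fun l => -if p l < n l then (1 : ℂ) else 0) (Finset.univ : Finset (Fin d))
    have h4 : ∀ t ∈ (Finset.univ : Finset (Fin d)).powerset,
        (-1 : ℂ) ^ (Finset.univ \ t).card *
        (a p * (walshD p g : ℂ) *
          if ∀ l, p l < (if l ∈ t then n l + 1 else n l) then 1 else 0) =
        (a p * (walshD p g : ℂ)) * ((∏ l ∈ t, if p l < n l + 1 then (1 : ℂ) else 0) *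
          ∏ l ∈ Finset.univ \ t, -if p l < n l then (1 : ℂ) else 0) := by
      intro t _
      rw [Finset.prod_neg, Finset.prod_ite_zero, Finset.prod_ite_zero]
      have : (∀ l, p l < (if l ∈ t then n l + 1 else n l)) ↔
          ((∀ l ∈ t, p l < n l + 1) ∧ ∀ l ∈ Finset.univ \ t, p l < n l) := by
        constructor
        · intro h
          refine ⟨fun l hl => by simpa [hl] using h l, fun l hl => ?_⟩
          have hl' : l ∉ t := by simpa using hl
          simpa [hl'] using h l
        · rintro ⟨h1, h2⟩ l
          by_cases hl : l ∈ t
          · simpa [hl] using h1 l hl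
          · simpa [hl] using h2 l (by simpa using hl)
      by_cases hA : ∀ l ∈ t, p l < n l + 1 <;>
        by_cases hB : ∀ l ∈ Finset.univ \ t, p l < n l
      · rw [if_pos (this.2 ⟨hA, hB⟩), if_pos hA, if_pos hB]; simp; ring
      · rw [if_neg (fun h => hB (this.1 h).2), if_neg hB]; simp
      · rw [if_neg (fun h => hA (this.1 h).1), if_neg hA]; simp
      · rw [if_neg (fun h => hA (this.1 h).1), if_neg hA]; simp
    rw [Finset.sum_congr rfl h4, ← Finset.mul_sum, ← h3]
    have hp' := (mem_boxLt _ _).1 hp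
    split_ifs with hpn
    · subst hpn
      simp
    · obtain ⟨l, hl⟩ := Function.ne_iff.1 hpn
      rw [Finset.prod_eq_zero (Finset.mem_univ l), mul_zero]
      have := hp' l
      rw [if_pos this, if_pos (by omega)]
      ring
  rw [Finset.sum_congr rfl h2, Finset.sum_ite_eq' , if_pos]
  rw [mem_boxLt]
  intro l
  omega

lemma xor_block (m n k : ℕ) (hm : m < 2 ^ k) (hn : 2 ^ k ≤ n ∧ n < 2 ^ (k + 1)) :
    2 ^ k ≤ m ^^^ n ∧ m ^^^ n < 2 ^ (k + 1) := by
  have hlt : m ^^^ n < 2 ^ (k + 1) :=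
    Nat.xor_lt_two_pow (hm.trans (Nat.pow_lt_pow_right (by norm_num) (by omega))) hn.2
  refine ⟨?_, hlt⟩
  apply Nat.ge_two_pow_of_testBit
  rw [Nat.testBit_xor, Nat.testBit_lt_two_pow hm]
  by_contra hb
  have := lt_of_bit _ _ hn.2 (by simpa using hb)
  omega

lemma lambda_case (hd : 2 ≤ d) (nseq : ℕ → Fin d → ℕ) (kseq : ℕ → ℕ)
    (hblock : ∀ i j, 2 ^ kseq i ≤ nseq i j ∧ nseq i j < 2 ^ (kseq i + 1))
    (hktop : Tendsto kseq atTop atTop) : ¬ IsMSetLambda 2 (Fset nseq) := by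
  rintro ⟨a, ⟨m, hm⟩, hconv⟩
  apply hm
  have hP : ∀ g ∉ Fset nseq, Tendsto (fun j => P a j g) atTop (𝓝 0) := by
    intro g hg
    rw [Metric.tendsto_atTop]
    intro ε hε
    obtain ⟨K, hK⟩ := hconv g hg ε hε
    refine ⟨K, fun j hj => ?_⟩
    rw [dist_eq_norm]
    refine hK _ (fun _ => hj.trans Nat.lt_two_pow_self.le) (fun _ _ => ?_)
    have : (0 : ℝ) ≤ ((2 ^ j : ℕ) : ℝ) := Nat.cast_nonneg _
    linarith
  obtain ⟨g, -, hg⟩ := F_nowhere hd nseq kseq hblock hktop 0 (0 : GD d)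
  have hbound : ∀ ε : ℝ, 0 < ε → ‖a m‖ ≤ 2 ^ d * ε := by
    intro ε hε
    obtain ⟨K, hK⟩ := hconv g hg ε hε
    obtain ⟨i, hi⟩ := (hktop.eventually_ge_atTop (K + ∑ l, m l)).exists
    set n : Fin d → ℕ := fun l => m l ^^^ nseq i l with hn
    have hml : ∀ l, m l < 2 ^ kseq i := by
      intro l
      refine lt_of_le_of_lt ?_ Nat.lt_two_pow_self
      have := Finset.single_le_sum (f := m) (fun _ _ => Nat.zero_le _) (Finset.mem_univ l)
      omega
    have hnb : ∀ l, 2 ^ kseq i ≤ n l ∧ n l < 2 ^ (kseq i + 1) := fun l =>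
      xor_block _ _ _ (hml l) (hblock i l)
    have hKk : K ≤ 2 ^ kseq i := le_trans (by omega) Nat.lt_two_pow_self.le
    have hmix := mixed a n g
    have hnorm : ‖a n‖ = ‖a n * (walshD n g : ℂ)‖ := by rw [norm_mul, walshD_norm, mul_one]
    rw [← shift_inv a nseq hP i m, hnorm, ← hmix]
    refine (norm_sum_le _ _).trans ?_
    have : ∀ t ∈ (Finset.univ : Finset (Fin d)).powerset, ‖(-1 : ℂ) ^ (Finset.univ \ t).card *
      walshPartialSum a (fun l => if l ∈ t then n l + 1 else n l) g‖ ≤ ε := by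
      intro t _
      rw [norm_mul, norm_pow, norm_neg, norm_one, one_pow, one_mul]
      have hNb : ∀ l, 2 ^ kseq i ≤ (if l ∈ t then n l + 1 else n l) ∧
          (if l ∈ t then n l + 1 else n l) ≤ 2 * 2 ^ kseq i := by
        intro l
        have := hnb l
        rw [pow_succ] at this
        split_ifs <;> omega
      have h := hK (fun l => if l ∈ t then n l + 1 else n l) (fun l => hKk.trans (hNb l).1) ?_
      · rw [sub_zero] at h
        exact h.le
      · intro j k
        have : (if j ∈ t then n j + 1 else n j) ≤ 2 * (if k ∈ t then n k + 1 else n k) := by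
          have h1 := (hNb j).2
          have h2 := (hNb k).1
          omega
        exact_mod_cast this
    refine (Finset.sum_le_card_nsmul _ _ _ this).trans ?_
    rw [Finset.card_powerset, Finset.card_univ, Fintype.card_fin]
    simp
  have : ‖a m‖ ≤ 0 := by
    apply le_of_forall_pos_le_add
    intro ε hε
    have := hbound (ε / 2 ^ d) (by positivity)
    rw [mul_div_cancel₀] at this
    · simpa using this
    · positivity
  simpa using this

lemma walsh_cont (n : ℕ) : Continuous (walsh n) := by
  unfold walsh
  refine continuous_finsetProd _ fun k _ => ?_
  exact (continuous_of_discreteTopology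
    (f := fun z : ZMod 2 => if n.testBit k ∧ z = 1 then (-1 : ℝ) else 1)).comp (continuous_apply k)

lemma walshD_cont (n : Fin d → ℕ) : Continuous (walshD n) := by
  unfold walshD
  exact continuous_finsetProd _ fun l _ => (walsh_cont _).comp (continuous_apply l)

lemma ps_cont (a : (Fin d → ℕ) → ℂ) (N : Fin d → ℕ) : Continuous (walshPartialSum a N) := by
  unfold walshPartialSum
  exact continuous_finsetSum _ fun n _ =>
    continuous_const.mul (Complex.continuous_ofReal.comp (walshD_cont n))

lemma open_agree (U : Set (GD d)) (hU : IsOpen U) (g : GD d) (hg : g ∈ U) :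
    ∃ k, ∀ g', agree k g g' → g' ∈ U := by
  by_contra hcon
  push Not at hcon
  choose f hf1 hf2 using hcon
  have ht : Tendsto f atTop (𝓝 g) := by
    rw [tendsto_pi_nhds]
    intro l
    rw [tendsto_pi_nhds]
    intro t
    apply tendsto_const_nhds.congr'
    filter_upwards [eventually_gt_atTop t] with k hk
    exact hf1 k l t hk
  obtain ⟨k, hk⟩ := (ht.eventually (hU.mem_nhds hg)).exists
  exact hf2 k hk

lemma agree_open (k : ℕ) (g : GD d) : IsOpen {g' : GD d | agree k g g'} := by
  have : {g' : GD d | agree k g g'} =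
      ⋂ l : Fin d, ⋂ t : Fin k, {g' : GD d | g l t = g' l t} := by
    ext g'
    simp only [agree, Set.mem_ofPred_eq, Set.mem_iInter]
    exact ⟨fun h l t => h l t t.2, fun h l t ht => h l ⟨t, ht⟩⟩
  rw [this]
  refine isOpen_iInter_of_finite fun l => isOpen_iInter_of_finite fun t => ?_
  exact (isOpen_discrete {z : ZMod 2 | g l t = z}).preimage
    ((continuous_apply (t : ℕ)).comp (continuous_apply l))

lemma F_closed (nseq : ℕ → Fin d → ℕ) : IsClosed (Fset nseq) := by
  unfold Fset
  rw [Set.ofPred_forall]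
  exact isClosed_iInter fun i => isClosed_eq (walshD_cont _) continuous_const

/-- The cubic shell. -/
def shell (d M : ℕ) : Finset (Fin d → ℕ) :=
  boxLt (fun _ => M + 1) \ boxLt (fun _ => M)

/-- Shell sum. -/
def Q (a : (Fin d → ℕ) → ℂ) (M : ℕ) (g : GD d) : ℂ :=
  ∑ n ∈ shell d M, a n * (walshD n g : ℂ)

lemma mem_shell (M : ℕ) (n : Fin d → ℕ) :
    n ∈ shell d M ↔ (∀ l, n l ≤ M) ∧ ∃ l, n l = M := by
  unfold shell
  rw [Finset.mem_sdiff, mem_boxLt, mem_boxLt]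
  push Not
  constructor
  · rintro ⟨h1, l, h2⟩
    exact ⟨fun l => Nat.lt_succ_iff.1 (h1 l), l, le_antisymm (Nat.lt_succ_iff.1 (h1 l)) h2⟩
  · rintro ⟨h1, l, h2⟩
    exact ⟨fun l => Nat.lt_succ_iff.2 (h1 l), l, h2.ge⟩

lemma Q_eq (a : (Fin d → ℕ) → ℂ) (M : ℕ) (g : GD d) :
    Q a M g = walshPartialSum a (fun _ => M + 1) g - walshPartialSum a (fun _ => M) g := by
  unfold Q shell walshPartialSum
  rw [eq_sub_iff_add_eq]
  apply Finset.sum_sdiff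
  intro n hn
  rw [mem_boxLt] at hn ⊢
  intro l
  have := hn l
  omega

lemma xor_eq_add (c p r : ℕ) (hc : 2 ^ r ∣ c) (hp : p < 2 ^ r) : p ^^^ c = c + p := by
  obtain ⟨q, rfl⟩ := hc
  rw [Nat.two_pow_add_eq_or_of_lt hp]
  apply Nat.eq_of_testBit_eq
  intro t
  rw [Nat.testBit_xor, Nat.testBit_or, Nat.testBit_two_pow_mul]
  by_cases ht : r ≤ t
  · rw [Nat.testBit_lt_two_pow (lt_of_lt_of_le hp (Nat.pow_le_pow_right (by norm_num) ht))]
    simp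
  · simp [ht]

lemma Q_bound (a : (Fin d → ℕ) → ℂ) (c r M : ℕ) (hc : 2 ^ r ∣ c) (hM : M < 2 ^ r)
    (hinv : ∀ m : Fin d → ℕ, a (fun l => m l ^^^ c) = a m) (g : GD d) (ε : ℝ)
    (hε : ∀ g', agree r g g' → ‖Q a (c + M) g'‖ ≤ ε) : ‖Q a M g‖ ≤ ε := by
  set K := c + M with hK
  set T : Finset (Fin d × ℕ) := Finset.univ ×ˢ Finset.Ico r (K + 1) with hT
  have hmemT : ∀ x, x ∈ T ↔ r ≤ x.2 ∧ x.2 < K + 1 := by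
    intro x
    simp [hT]
  have h := avg a (shell d K) (fun _ => c) T g
  have hre : ∑ n ∈ (shell d K).filter
      (fun n => ∀ x ∈ T, (n x.1).testBit x.2 = c.testBit x.2),
        a n * ((walshD n g : ℂ) * (walshD (fun _ => c) g : ℂ)) = Q a M g := by
    symm
    unfold Q
    refine Finset.sum_bij (fun p _ => fun l => p l ^^^ c) ?_ ?_ ?_ ?_
    · intro p hp
      rw [mem_shell] at hp
      rw [Finset.mem_filter, mem_shell]
      have hadd : ∀ l, p l ^^^ c = c + p l := fun l =>
        xor_eq_add c (p l) r hc (lt_of_le_of_lt (hp.1 l) hM)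
      refine ⟨⟨fun l => ?_, ?_⟩, ?_⟩
      · rw [hadd]
        have := hp.1 l
        omega
      · obtain ⟨l, hl⟩ := hp.2
        exact ⟨l, by rw [hadd, hl]⟩
      · intro x hx
        rw [Nat.testBit_xor, Nat.testBit_lt_two_pow (lt_of_le_of_lt (hp.1 x.1)
          (lt_of_lt_of_le hM (Nat.pow_le_pow_right (by norm_num) ((hmemT x).1 hx).1)))]
        simp
    · intro p _ q _ hpq
      funext l
      exact Nat.xor_left_injective (congrFun hpq l)
    · intro n hn
      rw [Finset.mem_filter, mem_shell] at hn
      obtain ⟨⟨h1, l0, h2⟩, h3⟩ := hn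
      have hlt : ∀ l, n l ^^^ c < 2 ^ r := by
        intro l
        apply Nat.lt_pow_two_of_testBit
        intro t ht
        rw [Nat.testBit_xor]
        by_cases htK : t < K + 1
        · have := h3 (l, t) ((hmemT _).2 ⟨ht, htK⟩)
          simp only at this
          rw [this]
          simp
        · have hKt : K < 2 ^ t := lt_trans (by omega) (Nat.lt_two_pow_self (n := t))
          rw [Nat.testBit_lt_two_pow (lt_of_le_of_lt (h1 l) hKt),
            Nat.testBit_lt_two_pow (x := c) (by omega)]
          rfl
      have hadd : ∀ l, n l = c + (n l ^^^ c) := by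
        intro l
        rw [← xor_eq_add c _ r hc (hlt l), Nat.xor_assoc, Nat.xor_self, Nat.xor_zero]
      refine ⟨fun l => n l ^^^ c, ?_, ?_⟩
      · rw [mem_shell]
        refine ⟨fun l => ?_, l0, ?_⟩
        · have := hadd l
          have := h1 l
          omega
        · have := hadd l0
          omega
      · funext l
        rw [Nat.xor_assoc, Nat.xor_self, Nat.xor_zero]
    · intro p _
      rw [hinv p, walshD_xor p (fun _ => c)]
      have := congrArg (fun r : ℝ => (r : ℂ)) (walshD_sq (fun _ => c) g)
      simp only [Complex.ofReal_mul, Complex.ofReal_one] at this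
      rw [Complex.ofReal_mul, mul_assoc, this, mul_one]
  rw [hre] at h
  have hle : ‖(2 : ℂ) ^ T.card * Q a M g‖ ≤ 2 ^ T.card * ε := by
    rw [← h]
    refine (norm_sum_le _ _).trans ?_
    refine (Finset.sum_le_card_nsmul _ _ ε ?_).trans ?_
    · intro s hs
      rw [norm_mul, walshD_norm, one_mul]
      exact hε _ (agree_pt r g s fun x hx => ((hmemT x).1 (Finset.mem_powerset.1 hs hx)).1)
    · rw [Finset.card_powerset]
      simp
  rw [norm_mul, norm_pow] at hle
  simpa using hle

lemma agree_trans (k k' : ℕ) (hk : k ≤ k') (g g' g'' : GD d) (h : agree k g g')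
    (h' : agree k' g' g'') : agree k g g'' := fun l t ht =>
  (h l t ht).trans (h' l t (by omega))

lemma cubes_case (hd : 2 ≤ d) (nseq : ℕ → Fin d → ℕ) (hpos : ∀ i j, 1 ≤ nseq i j)
    (hval : ∀ j, Tendsto (fun i => padicValNat 2 (nseq i j)) atTop atTop)
    (kseq : ℕ → ℕ)
    (hblock : ∀ i j, 2 ^ kseq i ≤ nseq i j ∧ nseq i j < 2 ^ (kseq i + 1))
    (hktop : Tendsto kseq atTop atTop) (hc : ∀ i, ∃ c : ℕ, nseq i = fun _ => c) :
    ¬ IsMSetCubes (Fset nseq) := by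
  rintro ⟨a, ⟨m, hm⟩, hconv⟩
  apply hm
  choose c hc using hc
  have hP : ∀ g ∉ Fset nseq, Tendsto (fun j => P a j g) atTop (𝓝 0) := fun g hg =>
    (hconv g hg).comp (tendsto_pow_atTop_atTop_of_one_lt (by norm_num : 1 < 2))
  have hQ : ∀ g ∉ Fset nseq, Tendsto (fun N => Q a N g) atTop (𝓝 0) := by
    intro g hg
    have h := hconv g hg
    have h2 := ((tendsto_add_atTop_iff_nat 1).2 h).sub h
    rw [sub_zero] at h2
    exact h2.congr fun N => (Q_eq a N g).symm
  have hQcont : ∀ N, Continuous (Q a N) := by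
    intro N
    rw [show Q a N = fun g => _ from funext fun g => Q_eq a N g]
    exact (ps_cont _ _).sub (ps_cont _ _)
  have hQcongr : ∀ M g g', agree M g g' → Q a M g = Q a M g' := by
    intro M g g' h
    unfold Q
    refine Finset.sum_congr rfl fun n hn => ?_
    rw [walshD_congr n M (fun l => lt_of_le_of_lt (((mem_shell _ _).1 hn).1 l)
      Nat.lt_two_pow_self) g g' h]
  have hQ0 : ∀ M g, Q a M g = 0 := by
    intro M g0
    have hb : ∀ ε : ℝ, 0 < ε → ‖Q a M g0‖ ≤ ε := by
      intro ε hε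
      let E : ℕ → Set (GD d) := fun I => {g | ∀ N ≥ I, ‖Q a N g‖ ≤ ε} ∪ Fset nseq
      have hEc : ∀ I, IsClosed (E I) := by
        intro I
        refine IsClosed.union ?_ (F_closed nseq)
        simp only [Set.ofPred_forall]
        exact isClosed_iInter fun N => isClosed_iInter fun _ =>
          isClosed_le (hQcont N).norm continuous_const
      have hEU : ⋃ I, E I = Set.univ := by
        rw [Set.eq_univ_iff_forall]
        intro g
        rw [Set.mem_iUnion]
        by_cases hg : g ∈ Fset nseq
        · exact ⟨0, Or.inr hg⟩
        · have := (hQ g hg).norm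
          rw [norm_zero] at this
          obtain ⟨I, hI⟩ := eventually_atTop.1 (this.eventually_le_const hε)
          exact ⟨I, Or.inl hI⟩
      have hdense := dense_iUnion_interior_of_closed hEc hEU
      obtain ⟨g1, hg1, hg1F⟩ := F_nowhere hd nseq kseq hblock hktop M g0
      obtain ⟨g2, ⟨hg2a, hg2F⟩, hg2⟩ := hdense.inter_open_nonempty
        ({g' | agree M g0 g'} ∩ (Fset nseq)ᶜ)
        ((agree_open M g0).inter (F_closed nseq).isOpen_compl) ⟨g1, hg1, hg1F⟩
      obtain ⟨I, hI⟩ := Set.mem_iUnion.1 hg2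
      obtain ⟨r0, hr0⟩ := open_agree (interior (E I) ∩ (Fset nseq)ᶜ)
        (isOpen_interior.inter (F_closed nseq).isOpen_compl) g2 ⟨hI, hg2F⟩
      set r := max r0 M with hr
      let l0 : Fin d := ⟨0, by omega⟩
      obtain ⟨i, hi1, hi2⟩ := (((hval l0).eventually_ge_atTop r).and
        (hktop.eventually_ge_atTop I)).exists
      have hci : nseq i l0 = c i := congrFun (hc i) l0
      have hdvd : 2 ^ r ∣ c i := by
        rw [← hci]
        exact (pow_dvd_pow 2 hi1).trans pow_padicValNat_dvd
      have hge : I ≤ c i := by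
        have := (hblock i l0).1
        rw [hci] at this
        exact hi2.trans (Nat.lt_two_pow_self.le.trans this)
      rw [hQcongr M g0 g2 hg2a]
      refine Q_bound a (c i) r M hdvd (lt_of_le_of_lt (le_max_right r0 M) Nat.lt_two_pow_self)
        ?_ g2 ε ?_
      · intro m
        have := shift_inv a nseq hP i m
        rw [hc i] at this
        exact this
      · intro g' hg'
        have := hr0 g' fun l t ht => hg' l t (lt_of_lt_of_le ht (le_max_left _ _))
        rcases interior_subset this.1 with h | h
        · exact h _ (by omega)
        · exact absurd h this.2
    have : ‖Q a M g0‖ ≤ 0 := le_of_forall_pos_le_add fun ε hε => by simpa using hb ε hε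
    simpa using this
  have hS : ∀ M g, walshPartialSum a (fun _ => M) g = 0 := by
    intro M g
    induction M with
    | zero =>
      unfold walshPartialSum
      apply Finset.sum_eq_zero
      intro n hn
      exact absurd ((mem_boxLt _ _).1 hn ⟨0, by omega⟩) (by omega)
    | succ M ih =>
      have := Q_eq a M g
      rw [hQ0, ih, sub_zero] at this
      exact this.symm
  have he := extract a (∑ l, m l) m (fun l => by
    refine lt_of_le_of_lt ?_ Nat.lt_two_pow_self
    exact Finset.single_le_sum (f := m) (fun _ _ => Nat.zero_le _) (Finset.mem_univ l))
  have hz : ∀ g, P a (∑ l, m l) g = 0 := fun g => hS _ g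
  simp only [hz, mul_zero, Finset.sum_const_zero] at he
  rcases mul_eq_zero.1 he.symm with h | h
  · exact absurd h (pow_ne_zero _ two_ne_zero)
  · exact h

end WalshU

/-- for a sequence `(𝐧_i)` whose 2-adic valuations tend to infinity
coordinatewise and which lies in blocks `B_{k_i}` with `k_i → ∞`, the set
`F = {𝐠 : W_{𝐧_i}(𝐠) = 1 ∀i}` is a U-set under `λ`-convergence for some `λ ∈ [1,2]`,
and under convergence over cubes if `𝐧_i = n_i𝟏`. -/
theorem statement18 (d : ℕ) (hd : 2 ≤ d)
    (nseq : ℕ → Fin d → ℕ) (hpos : ∀ i j, 1 ≤ nseq i j)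
    (hval : ∀ j, Tendsto (fun i => padicValNat 2 (nseq i j)) atTop atTop)
    (kseq : ℕ → ℕ)
    (hblock : ∀ i j, 2 ^ kseq i ≤ nseq i j ∧ nseq i j < 2 ^ (kseq i + 1))
    (hktop : Tendsto kseq atTop atTop) :
    (∃ lam : ℝ, 1 ≤ lam ∧ lam ≤ 2 ∧
      ¬IsMSetLambda lam {g : GD d | ∀ i, walshD (nseq i) g = 1}) ∧
    ((∀ i, ∃ c : ℕ, nseq i = fun _ => c) →
      ¬IsMSetCubes {g : GD d | ∀ i, walshD (nseq i) g = 1}) := by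
    exact ⟨⟨2, by norm_num, le_rfl, WalshU.lambda_case hd nseq kseq hblock hktop⟩,
    fun hc => WalshU.cubes_case hd nseq hpos hval kseq hblock hktop hc⟩
end
end

section
/- Let π ∈ S' and let G ⊆ 𝔾^d be an open set with G ∩ F^π ≠ ∅. Then G ∩ F^π is an M-set for the d-dimensional Walsh system under rectangular convergence, convergence over cubes, and iterated convergence in any order. Moreover, there exist s₀ ∈ ℕ and a dyadic cube Δ* of rank m_{s₀} with Δ* ⊆ G and Δ* ∩ F^π ≠ ∅ such that the d-multiple Walsh series whose coefficients are the Fourier–Walsh coefficients of the restricted quasimeasure τ_{F^π}|_{Δ*} is not identically zero and converges to 0 over rectangles at every point of 𝔾^d ∖ (G ∩ F^π). -/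
open Filter Finset Topology MeasureTheory
open scoped Classical

noncomputable section

/-! ### One-dimensional Walsh functions -/

/-- A function depends only on the first `j` bits. -/
def Dep (j : ℕ) (f : DyadicGroup → ℝ) : Prop :=
  ∀ x y : DyadicGroup, (∀ t < j, x t = y t) → f x = f y

lemma walsh_eq {n k : ℕ} (h : n < 2 ^ k) (g : DyadicGroup) :
    walsh n g = ∏ t ∈ Finset.range k, if n.testBit t ∧ g t = 1 then (-1 : ℝ) else 1 := by
  unfold walsh
  have key : ∀ K L : ℕ, n < 2 ^ K → K ≤ L →
      (∏ t ∈ Finset.range K, if n.testBit t ∧ g t = 1 then (-1 : ℝ) else 1) =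
      ∏ t ∈ Finset.range L, if n.testBit t ∧ g t = 1 then (-1 : ℝ) else 1 := by
    intro K L hK hKL
    apply Finset.prod_subset
    · intro t; simp only [Finset.mem_range]; omega
    · intro t _ ht
      simp only [Finset.mem_range, not_lt] at ht
      have : n.testBit t = false :=
        Nat.testBit_lt_two_pow (lt_of_lt_of_le hK (Nat.pow_le_pow_right (by norm_num) ht))
      simp [this]
  rw [key n (max n k) Nat.lt_two_pow_self (le_max_left _ _),
    key k (max n k) h (le_max_right _ _)]

lemma walsh_zero (x : DyadicGroup) : walsh 0 x = 1 := by simp [walsh]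

lemma walsh_add {j i : ℕ} (a : ℕ) (h : i < 2 ^ j) (x : DyadicGroup) :
    walsh (2 ^ j * a + i) x = walsh (2 ^ j * a) x * walsh i x := by
  set K := 2 ^ j * a + i with hK
  have h1 : K < 2 ^ K := Nat.lt_two_pow_self
  have h2 : 2 ^ j * a < 2 ^ K := lt_of_le_of_lt (by omega) h1
  have h3 : i < 2 ^ K := lt_of_le_of_lt (by omega) h1
  rw [walsh_eq h1, walsh_eq h2, walsh_eq h3, ← Finset.prod_mul_distrib]
  apply Finset.prod_congr rfl
  intro t _
  rw [hK, Nat.testBit_two_pow_mul_add a h, Nat.testBit_two_pow_mul]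
  by_cases ht : t < j
  · simp [ht, not_le.mpr ht]
  · have : i.testBit t = false :=
      Nat.testBit_lt_two_pow (lt_of_lt_of_le h (Nat.pow_le_pow_right (by norm_num) (by omega)))
    simp [ht, this, not_lt.mp ht]

lemma walsh_two_pow_add {j i : ℕ} (h : i < 2 ^ j) (x : DyadicGroup) :
    walsh (2 ^ j + i) x = walsh (2 ^ j) x * walsh i x := by
  simpa using walsh_add 1 h x

lemma walsh_two_pow (j : ℕ) (x : DyadicGroup) :
    walsh (2 ^ j) x = if x j = 1 then -1 else 1 := by
  rw [walsh_eq (Nat.pow_lt_pow_right (by norm_num) (Nat.lt_succ_self j)), Finset.prod_range_succ,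
    Finset.prod_eq_one]
  · simp
  · intro t ht
    have : j ≠ t := by have := Finset.mem_range.mp ht; omega
    simp [this]

lemma walsh_dep {n k : ℕ} (h : n < 2 ^ k) : Dep k (walsh n) := by
  intro x y hxy
  rw [walsh_eq h, walsh_eq h]
  apply Finset.prod_congr rfl
  intro t ht
  rw [hxy t (Finset.mem_range.mp ht)]

lemma walsh_cases (n : ℕ) (x : DyadicGroup) : walsh n x = 1 ∨ walsh n x = -1 := by
  unfold walsh
  induction Finset.range n using Finset.induction_on with
  | empty => simp
  | insert a s ha ih =>
    rw [Finset.prod_insert ha]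
    split_ifs <;> rcases ih with h | h <;> rw [h] <;> simp

lemma walsh_abs (n : ℕ) (x : DyadicGroup) : |walsh n x| = 1 := by
  rcases walsh_cases n x with h | h <;> rw [h] <;> simp

lemma walsh_sq (n : ℕ) (x : DyadicGroup) : walsh n x * walsh n x = 1 := by
  rcases walsh_cases n x with h | h <;> rw [h] <;> norm_num

lemma zmod2_cases (a : ZMod 2) : a = 0 ∨ a = 1 := by
  revert a; decide

lemma zmod2_iff (a b : ZMod 2) : a = b ↔ (a = 1 ↔ b = 1) := by
  revert a b; decide

lemma kernel_pow (k : ℕ) (x y : DyadicGroup) :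
    ∑ i ∈ Finset.range (2 ^ k), walsh i x * walsh i y =
      if ∀ t < k, x t = y t then (2 : ℝ) ^ k else 0 := by
  induction k with
  | zero => simp [walsh_zero]
  | succ k ih =>
    rw [pow_succ, mul_two, Finset.sum_range_add]
    have : ∑ i ∈ Finset.range (2 ^ k), walsh (2 ^ k + i) x * walsh (2 ^ k + i) y =
        (walsh (2 ^ k) x * walsh (2 ^ k) y) *
          ∑ i ∈ Finset.range (2 ^ k), walsh i x * walsh i y := by
      rw [Finset.mul_sum]
      apply Finset.sum_congr rfl
      intro i hi
      rw [walsh_two_pow_add (Finset.mem_range.mp hi), walsh_two_pow_add (Finset.mem_range.mp hi)]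
      ring
    rw [this, ih, walsh_two_pow, walsh_two_pow]
    have e : (∀ t < k + 1, x t = y t) ↔ (∀ t < k, x t = y t) ∧ (x k = y k) := by
      constructor
      · intro h; exact ⟨fun t ht => h t (by omega), h k (by omega)⟩
      · rintro ⟨h1, h2⟩ t ht
        rcases Nat.lt_succ_iff_lt_or_eq.mp ht with h | h
        · exact h1 t h
        · rw [h]; exact h2
    rw [if_congr e rfl rfl]
    by_cases h1 : ∀ t < k, x t = y t
    · rw [if_pos h1]
      by_cases h2 : x k = y k
      · have h3 : (∀ t < k, x t = y t) ∧ x k = y k := ⟨h1, h2⟩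
        rw [if_pos h3, h2]
        by_cases h4 : y k = 1
        · rw [if_pos h4]; ring
        · rw [if_neg h4]; ring
      · have h3 : ¬ ((∀ t < k, x t = y t) ∧ x k = y k) := fun h => h2 h.2
        rw [if_neg h3]
        rcases zmod2_cases (x k) with a | a <;> rcases zmod2_cases (y k) with b | b
        · exact absurd (a.trans b.symm) h2
        · rw [a, b]; simp
        · rw [a, b]; simp
        · exact absurd (a.trans b.symm) h2
    · have h3 : ¬ ((∀ t < k, x t = y t) ∧ x k = y k) := fun h => h1 h.1
      rw [if_neg h1, if_neg h3]; simp

/-- The index of the rank `n` dyadic interval containing `x`. -/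
def idx : ℕ → DyadicGroup → ℕ
  | 0, _ => 0
  | n + 1, x => 2 * idx n x + (if x n = 1 then 1 else 0)

lemma idx_lt (n : ℕ) (x : DyadicGroup) : idx n x < 2 ^ n := by
  induction n with
  | zero => simp [idx]
  | succ n ih => rw [idx, pow_succ]; split_ifs <;> omega

lemma mem_interval_iff {n m : ℕ} (hm : m < 2 ^ n) (x : DyadicGroup) :
    x ∈ dyadicInterval n m ↔ idx n x = m := by
  induction n generalizing m with
  | zero => simp at hm; simp [dyadicInterval, idx, hm]
  | succ n ih =>
    have h2 : m / 2 < 2 ^ n := by rw [pow_succ] at hm; omega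
    have : x ∈ dyadicInterval (n + 1) m ↔
        x ∈ dyadicInterval n (m / 2) ∧ x n = if m.testBit 0 then 1 else 0 := by
      simp only [dyadicInterval, Set.mem_ofPred_eq]
      have aux : ∀ t < n, m.testBit (n + 1 - 1 - t) = (m / 2).testBit (n - 1 - t) := by
        intro t ht
        rw [← Nat.testBit_succ]; congr 1; omega
      constructor
      · intro h
        refine ⟨fun t ht => ?_, ?_⟩
        · rw [h t (by omega), aux t ht]
        · rw [h n (by omega)]; simp
      · rintro ⟨h1, h3⟩ t ht
        rcases Nat.lt_succ_iff_lt_or_eq.mp ht with h | h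
        · rw [h1 t h, aux t h]
        · subst h; simpa using h3
    rw [this, ih h2, idx, Nat.testBit_zero]
    rcases Nat.mod_two_eq_zero_or_one m with hmm | hmm <;>
      rcases zmod2_cases (x n) with a | a <;> simp [a, hmm] <;> omega

lemma mem_interval_idx (n : ℕ) (x : DyadicGroup) : x ∈ dyadicInterval n (idx n x) :=
  (mem_interval_iff (idx_lt n x) x).mpr rfl

lemma pt_mem (k m : ℕ) : intervalPoint k m ∈ dyadicInterval k m := by
  intro t ht; simp [intervalPoint, ht]

lemma idx_pt {k m : ℕ} (hm : m < 2 ^ k) : idx k (intervalPoint k m) = m :=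
  (mem_interval_iff hm _).mp (pt_mem k m)

lemma agree_iff (k : ℕ) (x y : DyadicGroup) : (∀ t < k, x t = y t) ↔ idx k x = idx k y := by
  constructor
  · intro h
    symm
    rw [← mem_interval_iff (idx_lt k x)]
    intro t ht
    rw [← h t ht]
    exact mem_interval_idx k x t ht
  · intro h t ht
    rw [mem_interval_idx k x t ht, mem_interval_idx k y t ht, h]

lemma pt_idx_agree (k : ℕ) (x : DyadicGroup) : ∀ t < k, intervalPoint k (idx k x) t = x t :=
  (agree_iff k _ _).mpr (idx_pt (idx_lt k x))

lemma mem_interval_agree {k m : ℕ} {x : DyadicGroup} (h : x ∈ dyadicInterval k m) :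
    ∀ t < k, x t = intervalPoint k m t := by
  intro t ht; rw [h t ht, pt_mem k m t ht]

lemma walsh_symm {k i m : ℕ} (hi : i < 2 ^ k) (hm : m < 2 ^ k) :
    walsh i (intervalPoint k m) = walsh m (intervalPoint k i) := by
  rw [walsh_eq hi, walsh_eq hm, ← Finset.prod_range_reflect]
  apply Finset.prod_congr rfl
  intro t ht
  have ht := Finset.mem_range.mp ht
  have h1 : k - 1 - t < k := by omega
  have h2 : k - 1 - (k - 1 - t) = t := by omega
  simp only [intervalPoint, h1, h2, ht, true_and]
  cases h3 : i.testBit (k - 1 - t) <;> cases h4 : m.testBit t <;> simp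

/-- Average over the dyadic intervals of rank `k`. -/
def avg (k : ℕ) (f : DyadicGroup → ℝ) : ℝ :=
  ((2 : ℝ) ^ k)⁻¹ * ∑ m ∈ Finset.range (2 ^ k), f (intervalPoint k m)

lemma avg_orth {k i j : ℕ} (hi : i < 2 ^ k) (hj : j < 2 ^ k) :
    avg k (fun y => walsh i y * walsh j y) = if i = j then 1 else 0 := by
  unfold avg
  have : ∑ m ∈ Finset.range (2 ^ k), walsh i (intervalPoint k m) * walsh j (intervalPoint k m)
      = ∑ m ∈ Finset.range (2 ^ k), walsh m (intervalPoint k i) * walsh m (intervalPoint k j) := by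
    apply Finset.sum_congr rfl
    intro m hm
    have hm := Finset.mem_range.mp hm
    rw [walsh_symm hi hm, walsh_symm hj hm]
  rw [this, kernel_pow, if_congr (agree_iff k _ _) rfl rfl, idx_pt hi, idx_pt hj]
  split_ifs <;> simp

lemma avg_sum {ι : Type*} (k : ℕ) (s : Finset ι) (c : ι → ℝ) (φ : ι → DyadicGroup → ℝ) :
    avg k (fun y => ∑ i ∈ s, c i * φ i y) = ∑ i ∈ s, c i * avg k (φ i) := by
  simp only [avg, Finset.mul_sum]
  rw [Finset.sum_comm]
  apply Finset.sum_congr rfl; intro i _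
  apply Finset.sum_congr rfl; intro m _
  ring

/-- The Walsh partial sum of `f`, with coefficients computed at resolution `k`. -/
def SN (k N : ℕ) (f : DyadicGroup → ℝ) (x : DyadicGroup) : ℝ :=
  ∑ i ∈ Finset.range N, avg k (fun y => walsh i y * f y) * walsh i x

lemma coeff_sum {ι : Type*} (k n : ℕ) (s : Finset ι) (c : ι → ℝ) (w : ι → ℕ)
    (hn : n < 2 ^ k) (hw : ∀ i ∈ s, w i < 2 ^ k) :
    avg k (fun y => walsh n y * ∑ i ∈ s, c i * walsh (w i) y) =
      ∑ i ∈ s, if n = w i then c i else 0 := by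
  have : (fun y => walsh n y * ∑ i ∈ s, c i * walsh (w i) y) =
      fun y => ∑ i ∈ s, c i * (fun y => walsh n y * walsh (w i) y) y := by
    funext y; rw [Finset.mul_sum]; apply Finset.sum_congr rfl; intro i _; ring
  rw [this, avg_sum]
  apply Finset.sum_congr rfl; intro i hi
  rw [avg_orth hn (hw i hi)]; split_ifs <;> simp

lemma SN_sum {ι : Type*} (k N : ℕ) (s : Finset ι) (c : ι → ℝ) (w : ι → ℕ)
    (hN : N ≤ 2 ^ k) (hw : ∀ i ∈ s, w i < 2 ^ k) (x : DyadicGroup) :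
    SN k N (fun y => ∑ i ∈ s, c i * walsh (w i) y) x =
      ∑ i ∈ s, if w i < N then c i * walsh (w i) x else 0 := by
  unfold SN
  have : ∀ n ∈ Finset.range N,
      avg k (fun y => walsh n y * ∑ i ∈ s, c i * walsh (w i) y) * walsh n x =
        ∑ i ∈ s, if n = w i then c i * walsh (w i) x else 0 := by
    intro n hn
    rw [coeff_sum k n s c w (lt_of_lt_of_le (Finset.mem_range.mp hn) hN) hw, Finset.sum_mul]
    apply Finset.sum_congr rfl; intro i _
    split_ifs with h
    · rw [h]
    · simp
  rw [Finset.sum_congr rfl this, Finset.sum_comm]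
  apply Finset.sum_congr rfl; intro i _
  rw [Finset.sum_ite_eq']
  simp

lemma dep_expand {j : ℕ} {f : DyadicGroup → ℝ} (hf : Dep j f) :
    ∃ c : ℕ → ℝ, f = fun y => ∑ i ∈ Finset.range (2 ^ j), c i * walsh i y := by
  refine ⟨fun i => avg j (fun y => f y * walsh i y), ?_⟩
  funext x
  simp only [avg, Finset.mul_sum, Finset.sum_mul]
  rw [Finset.sum_comm]
  have : ∀ m ∈ Finset.range (2 ^ j), (∑ i ∈ Finset.range (2 ^ j),
      ((2 : ℝ) ^ j)⁻¹ * (f (intervalPoint j m) * walsh i (intervalPoint j m)) * walsh i x) =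
      if m = idx j x then f x else 0 := by
    intro m hm
    have hm := Finset.mem_range.mp hm
    have e : ∀ i ∈ Finset.range (2 ^ j), ((2 : ℝ) ^ j)⁻¹ *
        (f (intervalPoint j m) * walsh i (intervalPoint j m)) * walsh i x =
        ((2 : ℝ) ^ j)⁻¹ * f (intervalPoint j m) * (walsh i (intervalPoint j m) * walsh i x) := by
      intro i _; ring
    rw [Finset.sum_congr rfl e, ← Finset.mul_sum, kernel_pow, if_congr (agree_iff j _ _) rfl rfl,
      idx_pt hm]
    split_ifs with h
    · rw [h, hf _ x (pt_idx_agree j x)]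
      field_simp
    · simp
  rw [Finset.sum_congr rfl this, Finset.sum_ite_eq']
  simp [idx_lt]

/-! ### Partial sums of functions of finitely many bits -/

lemma pow_two_lt {a b : ℕ} (h : a < b) : 2 ^ a < 2 ^ b := Nat.pow_lt_pow_right (by norm_num) h
lemma pow_two_le {a b : ℕ} (h : a ≤ b) : 2 ^ a ≤ 2 ^ b := Nat.pow_le_pow_right (by norm_num) h

lemma Dep.mono {i j : ℕ} (h : i ≤ j) {f : DyadicGroup → ℝ} (hf : Dep i f) : Dep j f :=
  fun x y hxy => hf x y fun t ht => hxy t (by omega)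

lemma Dep.mul {j : ℕ} {f g : DyadicGroup → ℝ} (hf : Dep j f) (hg : Dep j g) :
    Dep j (fun x => f x * g x) := by
  intro x y h; simp only [hf x y h, hg x y h]

lemma coeff_low {j k n : ℕ} {f : DyadicGroup → ℝ} (hf : Dep j f) (hjk : j ≤ k)
    (hn : n < 2 ^ k) (hjn : 2 ^ j ≤ n) : avg k (fun y => walsh n y * f y) = 0 := by
  obtain ⟨c, rfl⟩ := dep_expand hf
  rw [coeff_sum k n _ c (fun i => i) hn]
  · apply Finset.sum_eq_zero
    intro i hi
    have := Finset.mem_range.mp hi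
    rw [if_neg (by omega)]
  · intro i hi
    exact lt_of_lt_of_le (Finset.mem_range.mp hi) (pow_two_le hjk)

lemma coeff_indep {j k k' n : ℕ} {f : DyadicGroup → ℝ} (hf : Dep j f) (hjk : j ≤ k)
    (hjk' : j ≤ k') (hn : n < 2 ^ j) :
    avg k (fun y => walsh n y * f y) = avg k' (fun y => walsh n y * f y) := by
  obtain ⟨c, rfl⟩ := dep_expand hf
  have aux : ∀ k, j ≤ k → avg k (fun y => walsh n y * ∑ i ∈ Finset.range (2 ^ j), c i * walsh i y)
      = ∑ i ∈ Finset.range (2 ^ j), if n = i then c i else 0 := by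
    intro k hjk
    rw [coeff_sum k n _ c (fun i => i) (lt_of_lt_of_le hn (pow_two_le hjk))]
    intro i hi
    exact lt_of_lt_of_le (Finset.mem_range.mp hi) (pow_two_le hjk)
  rw [aux k hjk, aux k' hjk']

lemma SN_low {j k N : ℕ} {f : DyadicGroup → ℝ} (hf : Dep j f) (hjN : 2 ^ j ≤ N)
    (hN : N ≤ 2 ^ k) (x : DyadicGroup) : SN k N f x = f x := by
  obtain ⟨c, rfl⟩ := dep_expand hf
  rw [SN_sum k N _ c (fun i => i) hN]
  · apply Finset.sum_congr rfl
    intro i hi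
    have := Finset.mem_range.mp hi
    rw [if_pos (by omega)]
  · intro i hi
    have := Finset.mem_range.mp hi
    omega

lemma coeff_high {j k n : ℕ} {h : DyadicGroup → ℝ} (hh : Dep j h) (hjk : j < k)
    (hn : n < 2 ^ j) : avg k (fun y => walsh n y * (walsh (2 ^ j) y * h y)) = 0 := by
  obtain ⟨c, rfl⟩ := dep_expand hh
  have e : (fun y => walsh n y *
      (walsh (2 ^ j) y * ∑ i ∈ Finset.range (2 ^ j), c i * walsh i y)) =
      fun y => walsh n y * ∑ i ∈ Finset.range (2 ^ j), c i * walsh (2 ^ j + i) y := by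
    funext y
    congr 1
    rw [Finset.mul_sum]
    apply Finset.sum_congr rfl
    intro i hi
    rw [walsh_two_pow_add (Finset.mem_range.mp hi)]
    ring
  rw [e, coeff_sum k n _ c (fun i => 2 ^ j + i) (hn.trans (pow_two_lt hjk))]
  · apply Finset.sum_eq_zero
    intro i _
    rw [if_neg (by omega)]
  · intro i hi
    have h1 := Finset.mem_range.mp hi
    have h2 : 2 ^ (j + 1) ≤ 2 ^ k := pow_two_le hjk
    rw [pow_succ] at h2
    omega

lemma SN_high {j k N : ℕ} {h : DyadicGroup → ℝ} (hh : Dep j h) (hjk : j < k)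
    (hN : N ≤ 2 ^ j) (x : DyadicGroup) : SN k N (fun y => walsh (2 ^ j) y * h y) x = 0 := by
  unfold SN
  apply Finset.sum_eq_zero
  intro i hi
  rw [coeff_high hh hjk (lt_of_lt_of_le (Finset.mem_range.mp hi) hN), zero_mul]

/-- Bound for the Dirichlet kernel away from the diagonal. -/
lemma kernel_bound {p : ℕ} (x y : DyadicGroup) (hxy : ¬ ∀ t < p, x t = y t) (r : ℕ) :
    |∑ i ∈ Finset.range r, walsh i x * walsh i y| ≤ 2 ^ p := by
  have block : ∀ a : ℕ, ∀ r ≤ 2 ^ p,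
      ∑ i ∈ Finset.range (2 ^ p * a + r), walsh i x * walsh i y =
        walsh (2 ^ p * a) x * walsh (2 ^ p * a) y *
          ∑ i ∈ Finset.range r, walsh i x * walsh i y := by
    intro a
    induction a with
    | zero => intro r _; simp [walsh_zero]
    | succ a ih =>
      intro r hr
      rw [Finset.sum_range_add]
      have h0 := ih (2 ^ p) le_rfl
      rw [kernel_pow, if_neg hxy, mul_zero] at h0
      rw [mul_add, mul_one, h0, zero_add, Finset.mul_sum]
      apply Finset.sum_congr rfl
      intro i hi
      have hi := Finset.mem_range.mp hi
      have := walsh_add (a + 1) (lt_of_lt_of_le hi hr) x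
      have h' := walsh_add (a + 1) (lt_of_lt_of_le hi hr) y
      rw [mul_add, mul_one] at this h'
      rw [this, h']
      ring
  have h1 := block (r / 2 ^ p) (r % 2 ^ p) (Nat.mod_lt _ (by positivity)).le
  rw [Nat.div_add_mod] at h1
  rw [h1, abs_mul, abs_mul, walsh_abs, walsh_abs, one_mul, one_mul]
  calc |∑ i ∈ Finset.range (r % 2 ^ p), walsh i x * walsh i y|
      ≤ ∑ i ∈ Finset.range (r % 2 ^ p), |walsh i x * walsh i y| := Finset.abs_sum_le_sum_abs _ _
    _ = (r % 2 ^ p : ℕ) := by simp [abs_mul, walsh_abs]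
    _ ≤ ((2 ^ p : ℕ) : ℝ) := by exact_mod_cast (Nat.mod_lt _ (by positivity)).le
    _ = 2 ^ p := by push_cast; rfl

lemma kernel_trivial (x y : DyadicGroup) (r : ℕ) :
    |∑ i ∈ Finset.range r, walsh i x * walsh i y| ≤ r := by
  calc |∑ i ∈ Finset.range r, walsh i x * walsh i y|
      ≤ ∑ i ∈ Finset.range r, |walsh i x * walsh i y| := Finset.abs_sum_le_sum_abs _ _
    _ = r := by simp [abs_mul, walsh_abs]

/-- The one-dimensional factor of the layer function. -/
def Rw (n : ℕ) (e : ℕ → ℕ) (x : DyadicGroup) : ℝ := walsh (2 ^ n * (2 ^ n + e (idx n x))) x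

lemma Rw_factor {n : ℕ} {e : ℕ → ℕ} (he : ∀ a < 2 ^ n, e a < 2 ^ n) (x : DyadicGroup) :
    Rw n e x = walsh (2 ^ (2 * n)) x * walsh (2 ^ n * e (idx n x)) x := by
  have : 2 ^ n * e (idx n x) < 2 ^ (2 * n) := by
    rw [two_mul, pow_add]
    exact Nat.mul_lt_mul_of_pos_left (he _ (idx_lt n x)) (by positivity)
  rw [← walsh_two_pow_add this, Rw, mul_add, two_mul, pow_add]

lemma Rw_tail_dep {n : ℕ} {e : ℕ → ℕ} (he : ∀ a < 2 ^ n, e a < 2 ^ n) :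
    Dep (2 * n) (fun x => walsh (2 ^ n * e (idx n x)) x) := by
  intro x y hxy
  have h1 : idx n x = idx n y := (agree_iff n x y).mp fun t ht => hxy t (by omega)
  simp only [h1]
  apply walsh_dep _ x y hxy
  rw [two_mul, pow_add]
  exact Nat.mul_lt_mul_of_pos_left (he _ (idx_lt n y)) (by positivity)

lemma Rw_dep {n : ℕ} {e : ℕ → ℕ} (he : ∀ a < 2 ^ n, e a < 2 ^ n) :
    Dep (2 * n + 1) (Rw n e) := by
  intro x y hxy
  have h := Rw_tail_dep he x y (fun t ht => hxy t (by omega))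
  simp only at h
  rw [Rw_factor he, Rw_factor he, h, walsh_dep (pow_two_lt (Nat.lt_succ_self _)) x y hxy]

lemma Rw_abs (n : ℕ) (e : ℕ → ℕ) (x : DyadicGroup) : |Rw n e x| = 1 := walsh_abs _ _

/-- Expansion of `h · R` in Walsh functions. -/
lemma hR_expand {n : ℕ} {e : ℕ → ℕ} {h : DyadicGroup → ℝ} (hh : Dep n h) :
    (fun y => h y * Rw n e y) = fun y =>
      ∑ mj ∈ Finset.range (2 ^ n) ×ˢ Finset.range (2 ^ n),
        (h (intervalPoint n mj.1) * ((2 : ℝ) ^ n)⁻¹ * walsh mj.2 (intervalPoint n mj.1)) *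
          walsh (2 ^ n * (2 ^ n + e mj.1) + mj.2) y := by
  funext x
  rw [Finset.sum_product]
  have : ∀ m ∈ Finset.range (2 ^ n), (∑ j ∈ Finset.range (2 ^ n),
        (h (intervalPoint n m) * ((2 : ℝ) ^ n)⁻¹ * walsh j (intervalPoint n m)) *
          walsh (2 ^ n * (2 ^ n + e m) + j) x) =
        if m = idx n x then h x * Rw n e x else 0 := by
    intro m hm
    have hm := Finset.mem_range.mp hm
    have e1 : ∀ j ∈ Finset.range (2 ^ n),
        (h (intervalPoint n m) * ((2 : ℝ) ^ n)⁻¹ * walsh j (intervalPoint n m)) *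
          walsh (2 ^ n * (2 ^ n + e m) + j) x =
        (h (intervalPoint n m) * ((2 : ℝ) ^ n)⁻¹ * walsh (2 ^ n * (2 ^ n + e m)) x) *
          (walsh j (intervalPoint n m) * walsh j x) := by
      intro j hj
      rw [walsh_add _ (Finset.mem_range.mp hj)]
      ring
    rw [Finset.sum_congr rfl e1, ← Finset.mul_sum, kernel_pow, if_congr (agree_iff n _ _) rfl rfl,
      idx_pt hm]
    split_ifs with h1
    · rw [h1, hh _ x (pt_idx_agree n x), Rw]
      field_simp
    · simp
  rw [Finset.sum_congr rfl this, Finset.sum_ite_eq']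
  simp [idx_lt]

/-- The key one-dimensional estimate. -/
lemma key_estimate {n p : ℕ} (hnp : n = 2 * p) {e : ℕ → ℕ} (he : ∀ a < 2 ^ n, e a < 2 ^ n)
    (hinj : ∀ a < 2 ^ n, ∀ b < 2 ^ n, e a = e b → a = b) (N : ℕ) (x : DyadicGroup) :
    ∃ θ : ℝ, |θ| ≤ 2 ∧ ∀ k, 2 * n < k → N ≤ 2 ^ k → ∀ h : DyadicGroup → ℝ, Dep p h →
      (∀ y, |h y| ≤ 1) →
      |SN k N (fun y => h y * Rw n e y) x - h x * θ| ≤ ((2 : ℝ) ^ p)⁻¹ := by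
  set r : ℕ → ℕ := fun m => min (N - 2 ^ n * (2 ^ n + e m)) (2 ^ n) with hr
  set K : ℕ → ℝ := fun m => ((2 : ℝ) ^ n)⁻¹ *
    ∑ j ∈ Finset.range (r m), walsh j (intervalPoint n m) * walsh j x with hK
  set T : ℕ → ℝ := fun m => walsh (2 ^ n * (2 ^ n + e m)) x * K m with hT
  set q : ℕ := N / 2 ^ n - 2 ^ n with hq
  have hpos : (0 : ℝ) < 2 ^ n := by positivity
  have hposN : 0 < 2 ^ n := by positivity
  -- bounds for K
  have hTK : ∀ m, |T m| = |K m| := by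
    intro m; simp only [hT]; rw [abs_mul, walsh_abs, one_mul]
  have hK1 : ∀ m, |K m| ≤ 1 := by
    intro m
    simp only [hK]
    rw [abs_mul, abs_inv, abs_of_pos hpos, inv_mul_le_iff₀ hpos, mul_one]
    refine (kernel_trivial _ _ _).trans ?_
    have : r m ≤ 2 ^ n := min_le_right _ _
    exact_mod_cast this
  have hK2 : ∀ m < 2 ^ n, m ≠ idx n x → e m ≠ q → K m = 0 := by
    intro m hm hne hq'
    have hdm := Nat.div_add_mod N (2 ^ n)
    have hml := Nat.mod_lt N hposN
    rcases Nat.lt_or_ge (N / 2 ^ n) (2 ^ n + e m) with hlt | hge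
    · have : r m = 0 := by
        have h1 : 2 ^ n * (N / 2 ^ n + 1) ≤ 2 ^ n * (2 ^ n + e m) := Nat.mul_le_mul_left _ hlt
        have : N - 2 ^ n * (2 ^ n + e m) = 0 := by
          apply Nat.sub_eq_zero_of_le
          rw [mul_add, mul_one] at h1
          omega
        simp [hr, this]
      simp [hK, this]
    · have hlt : 2 ^ n + e m + 1 ≤ N / 2 ^ n := by omega
      have : r m = 2 ^ n := by
        have h1 : 2 ^ n * (2 ^ n + e m + 1) ≤ 2 ^ n * (N / 2 ^ n) := Nat.mul_le_mul_left _ hlt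
        rw [mul_add _ _ 1, mul_one] at h1
        simp only [hr]
        apply min_eq_right
        omega
      simp only [hK, this]
      rw [kernel_pow, if_congr (agree_iff n _ _) rfl rfl, idx_pt hm, if_neg hne, mul_zero]
  have hK3 : ∀ m, ¬ (∀ t < p, intervalPoint n m t = x t) → |K m| ≤ ((2 : ℝ) ^ p)⁻¹ := by
    intro m hm
    simp only [hK]
    rw [abs_mul, abs_inv, abs_of_pos hpos, inv_mul_le_iff₀ hpos]
    refine (kernel_bound _ _ hm _).trans ?_
    rw [hnp, two_mul, pow_add, mul_assoc, mul_inv_cancel₀ (by positivity), mul_one]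
  set good : ℕ → Prop := fun m => ∀ t < p, intervalPoint n m t = x t with hgood
  refine ⟨∑ m ∈ (Finset.range (2 ^ n)).filter good, T m, ?_, ?_⟩
  · calc |∑ m ∈ (Finset.range (2 ^ n)).filter good, T m|
        ≤ ∑ m ∈ (Finset.range (2 ^ n)).filter good, |T m| := Finset.abs_sum_le_sum_abs _ _
      _ ≤ ∑ m ∈ Finset.range (2 ^ n), |T m| :=
          Finset.sum_le_sum_of_subset_of_nonneg (Finset.filter_subset _ _)
            (fun _ _ _ => abs_nonneg _)
      _ ≤ ∑ m ∈ Finset.range (2 ^ n),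
            ((if m = idx n x then (1 : ℝ) else 0) + if e m = q then 1 else 0) := by
          apply Finset.sum_le_sum
          intro m hm
          rw [hTK]
          by_cases h1 : m = idx n x
          · rw [if_pos h1]
            have := hK1 m
            split_ifs <;> linarith
          · by_cases h2 : e m = q
            · rw [if_pos h2, if_neg h1]; have := hK1 m; linarith
            · rw [hK2 m (Finset.mem_range.mp hm) h1 h2]; simp [h1, h2]
      _ ≤ 1 + 1 := by
          rw [Finset.sum_add_distrib]
          apply add_le_add
          · rw [Finset.sum_ite_eq']; split_ifs <;> norm_num
          · rw [Finset.sum_boole]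
            have : ((Finset.range (2 ^ n)).filter fun m => e m = q).card ≤ 1 := by
              apply Finset.card_le_one.mpr
              intro a ha b hb
              simp only [Finset.mem_filter, Finset.mem_range] at ha hb
              exact hinj a ha.1 b hb.1 (ha.2.trans hb.2.symm)
            exact_mod_cast this
      _ = 2 := by norm_num
  · intro k hk hN h hh hh1
    rw [hR_expand (hh.mono (by omega)), SN_sum k N _ _ _ hN]
    · rw [Finset.sum_product]
      have e1 : ∀ m ∈ Finset.range (2 ^ n), (∑ j ∈ Finset.range (2 ^ n),
          if 2 ^ n * (2 ^ n + e m) + j < N then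
            (h (intervalPoint n m) * ((2 : ℝ) ^ n)⁻¹ * walsh j (intervalPoint n m)) *
              walsh (2 ^ n * (2 ^ n + e m) + j) x else 0) = h (intervalPoint n m) * T m := by
        intro m _
        rw [← Finset.sum_filter]
        have : (Finset.range (2 ^ n)).filter (fun j => 2 ^ n * (2 ^ n + e m) + j < N) =
            Finset.range (r m) := by
          ext j
          simp only [Finset.mem_filter, Finset.mem_range, hr, lt_min_iff]
          omega
        rw [this]
        simp only [hT, hK, Finset.mul_sum]
        apply Finset.sum_congr rfl
        intro j hj
        have : j < 2 ^ n := lt_of_lt_of_le (Finset.mem_range.mp hj) (min_le_right _ _)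
        rw [walsh_add _ this]
        ring
      rw [Finset.sum_congr rfl e1, ← Finset.sum_filter_add_sum_filter_not _ good]
      have e2 : ∑ m ∈ (Finset.range (2 ^ n)).filter good, h (intervalPoint n m) * T m =
          h x * ∑ m ∈ (Finset.range (2 ^ n)).filter good, T m := by
        rw [Finset.mul_sum]
        apply Finset.sum_congr rfl
        intro m hm
        rw [hh _ x (Finset.mem_filter.mp hm).2]
      rw [e2, add_sub_cancel_left]
      calc |∑ m ∈ (Finset.range (2 ^ n)).filter (fun m => ¬ good m), h (intervalPoint n m) * T m|
          ≤ ∑ m ∈ (Finset.range (2 ^ n)).filter (fun m => ¬ good m),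
              |h (intervalPoint n m) * T m| := Finset.abs_sum_le_sum_abs _ _
        _ ≤ ∑ m ∈ (Finset.range (2 ^ n)).filter (fun m => ¬ good m),
              (if e m = q then ((2 : ℝ) ^ p)⁻¹ else 0) := by
            apply Finset.sum_le_sum
            intro m hm
            obtain ⟨hm1, hm2⟩ := Finset.mem_filter.mp hm
            rw [abs_mul, hTK]
            have b1 : |h (intervalPoint n m)| * |K m| ≤ |K m| := by
              have := hh1 (intervalPoint n m)
              have h0 := abs_nonneg (K m)
              nlinarith
            refine b1.trans ?_
            split_ifs with hq'
            · exact hK3 m hm2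
            · rw [hK2 m (Finset.mem_range.mp hm1) _ hq']
              · simp
              · intro h1
                apply hm2
                intro t ht
                rw [h1]
                exact pt_idx_agree n x t (by omega)
        _ ≤ ((2 : ℝ) ^ p)⁻¹ := by
            rw [← Finset.sum_filter, Finset.sum_const, nsmul_eq_mul]
            have : (((Finset.range (2 ^ n)).filter (fun m => ¬ good m)).filter
                fun m => e m = q).card ≤ 1 := by
              apply Finset.card_le_one.mpr
              intro a ha b hb
              simp only [Finset.mem_filter, Finset.mem_range] at ha hb
              exact hinj a ha.1.1 b hb.1.1 (ha.2.trans hb.2.symm)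
            have h2 : ((((Finset.range (2 ^ n)).filter (fun m => ¬ good m)).filter
                fun m => e m = q).card : ℝ) ≤ 1 := by exact_mod_cast this
            exact mul_le_of_le_one_left (by positivity) h2
    · rintro ⟨m, j⟩ hmj
      simp only [Finset.mem_product, Finset.mem_range] at hmj
      have h1 := he m hmj.1
      have h2 : 2 ^ n * (2 ^ n + e m + 1) ≤ 2 ^ n * (2 ^ n * 2) :=
        Nat.mul_le_mul_left _ (by omega)
      have h3 : 2 ^ n * (2 ^ n * 2) = 2 ^ (2 * n + 1) := by ring
      have h4 : 2 ^ (2 * n + 1) ≤ 2 ^ k := pow_two_le hk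
      rw [mul_add _ _ 1, mul_one] at h2
      simp only
      omega

/-! ### The multidimensional series -/

/-- The shifted sequence `m_{s+1}`. -/
def MM (s : ℕ) : ℕ := mSeq (s + 1)

lemma MM_zero : MM 0 = 0 := by simp [MM, mSeq]

lemma MM_succ (s : ℕ) : MM (s + 1) = 2 * (2 * MM s + 1) := by
  unfold MM; rw [mSeq]; simp

lemma MM_ge (s : ℕ) : s ≤ MM s := by
  induction s with
  | zero => simp
  | succ s ih => rw [MM_succ]; omega

lemma MM_step {i L : ℕ} (h : i < L) : 2 * MM i + 1 ≤ MM L := by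
  induction L with
  | zero => omega
  | succ L ih =>
    rw [MM_succ]
    rcases Nat.lt_succ_iff_lt_or_eq.mp h with h | h
    · have := ih h; omega
    · subst h; omega

lemma MM_mono {i L : ℕ} (h : i ≤ L) : MM i ≤ MM L := by
  rcases h.lt_or_eq with h | h
  · have := MM_step h; omega
  · rw [h]

/-- The one-dimensional factor `1_Δ ∏_{i ∈ A} R_i`. -/
def fA (r c : ℕ) (e : ℕ → ℕ → ℕ) (A : Finset ℕ) (x : DyadicGroup) : ℝ :=
  (if x ∈ dyadicInterval r c then 1 else 0) * ∏ i ∈ A, Rw (MM i) (e i) x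

/-- The admissible sequences of one-dimensional permutations. -/
def Adm (e : ℕ → ℕ → ℕ) : Prop :=
  ∀ s, (∀ a < 2 ^ MM s, e s a < 2 ^ MM s) ∧
    ∀ a < 2 ^ MM s, ∀ b < 2 ^ MM s, e s a = e s b → a = b

lemma fA_dep {r c j : ℕ} {e : ℕ → ℕ → ℕ} (he : Adm e) {A : Finset ℕ}
    (hA : ∀ i ∈ A, 2 * MM i + 1 ≤ j) (hr : r ≤ j) : Dep j (fA r c e A) := by
  intro x y hxy
  unfold fA
  congr 1
  · have : x ∈ dyadicInterval r c ↔ y ∈ dyadicInterval r c := by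
      unfold dyadicInterval
      constructor
      · intro h t ht; rw [← hxy t (by omega)]; exact h t ht
      · intro h t ht; rw [hxy t (by omega)]; exact h t ht
    rw [if_congr this rfl rfl]
  · apply Finset.prod_congr rfl
    intro i hi
    exact (Rw_dep (he i).1).mono (hA i hi) x y hxy

lemma fA_dep_range {r c L : ℕ} {e : ℕ → ℕ → ℕ} (he : Adm e) {A : Finset ℕ}
    (hA : A ⊆ Finset.range L) (hr : r ≤ 2 * MM L) : Dep (2 * MM L) (fA r c e A) := by
  apply fA_dep he _ hr
  intro i hi
  have := MM_step (Finset.mem_range.mp (hA hi))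
  omega

lemma fA_abs (r c : ℕ) (e : ℕ → ℕ → ℕ) (A : Finset ℕ) (x : DyadicGroup) :
    |fA r c e A x| ≤ 1 := by
  unfold fA
  rw [abs_mul, Finset.abs_prod]
  simp only [Rw_abs, Finset.prod_const_one, mul_one]
  split_ifs <;> simp

lemma fA_insert (r c : ℕ) (e : ℕ → ℕ → ℕ) {A : Finset ℕ} {i : ℕ} (hi : i ∉ A) :
    fA r c e (insert i A) = fun x => fA r c e A x * Rw (MM i) (e i) x := by
  funext x
  unfold fA
  rw [Finset.prod_insert hi]
  ring

lemma fA_high {r c s : ℕ} {e : ℕ → ℕ → ℕ} (he : Adm e) {A : Finset ℕ}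
    (hA : ¬ A ⊆ Finset.range s) (hr : r ≤ 2 * MM s) :
    ∃ i ∈ A, s ≤ i ∧ ∃ h, Dep (2 * MM i) h ∧
      fA r c e A = fun y => walsh (2 ^ (2 * MM i)) y * h y := by
  obtain ⟨a, haA, has⟩ := Finset.not_subset.mp hA
  have hne : A.Nonempty := ⟨a, haA⟩
  set i := A.max' hne with hi
  have hsi : s ≤ i := by
    have := A.le_max' a haA
    simp only [Finset.mem_range, not_lt] at has
    omega
  have hiA : i ∈ A := A.max'_mem hne
  refine ⟨i, hiA, hsi, fun x => fA r c e (A.erase i) x * walsh (2 ^ MM i * e i (idx (MM i) x)) x,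
    ?_, ?_⟩
  · apply Dep.mul
    · apply fA_dep_range he
      · intro b hb
        have h1 := Finset.mem_erase.mp hb
        have := A.le_max' b h1.2
        rw [Finset.mem_range]
        omega
      · have := MM_mono hsi; omega
    · exact Rw_tail_dep (he i).1
  · conv_lhs => rw [← Finset.insert_erase hiA]
    rw [fA_insert _ _ _ (Finset.notMem_erase i A)]
    funext x
    rw [Rw_factor (he i).1]
    ring

/-- The layer function `R_s(𝐠)`. -/
def Rd {d : ℕ} (e : Fin d → ℕ → ℕ → ℕ) (s : ℕ) (g : GD d) : ℝ :=
  ∏ l, Rw (MM s) (e l s) (g l)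

/-- The density of the restricted measure. -/
def densF {d : ℕ} (r : ℕ) (c : Fin d → ℕ) (e : Fin d → ℕ → ℕ → ℕ) (Λ : Finset ℕ) (g : GD d) : ℝ :=
  (if g ∈ dyadicCube r c then 1 else 0) * ∏ i ∈ Λ, (1 + Rd e i g)

lemma densF_expand {d : ℕ} (r : ℕ) (c : Fin d → ℕ) (e : Fin d → ℕ → ℕ → ℕ) (Λ : Finset ℕ)
    (g : GD d) : densF r c e Λ g = ∑ A ∈ Λ.powerset, ∏ l, fA r (c l) (e l) A (g l) := by
  unfold densF
  rw [Finset.prod_one_add, Finset.mul_sum]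
  apply Finset.sum_congr rfl
  intro A _
  unfold fA Rd
  rw [Finset.prod_mul_distrib, Finset.prod_comm]
  congr 1
  rw [Finset.prod_boole]
  simp [dyadicCube]
  congr

/-- The coefficients of the series. -/
def coef {d : ℕ} (r : ℕ) (c : Fin d → ℕ) (e : Fin d → ℕ → ℕ → ℕ) (L : ℕ) (n : Fin d → ℕ) : ℝ :=
  ∑ A ∈ (Finset.range L).powerset,
    ∏ l, avg (2 * MM L) (fun y => walsh (n l) y * fA r (c l) (e l) A y)

lemma coef_eq_dens {d : ℕ} (r : ℕ) (c : Fin d → ℕ) (e : Fin d → ℕ → ℕ → ℕ) (L : ℕ)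
    (n : Fin d → ℕ) : coef r c e L n =
      ∑ m ∈ boxLt (fun _ : Fin d => 2 ^ (2 * MM L)), walshValD (2 * MM L) n m *
        (((2 : ℝ) ^ (2 * MM L * d))⁻¹ *
          densF r c e (Finset.range L) (cubePoint (2 * MM L) m)) := by
  unfold coef
  simp only [densF_expand, Finset.mul_sum]
  rw [Finset.sum_comm]
  apply Finset.sum_congr rfl
  intro A _
  unfold avg
  rw [Finset.prod_mul_distrib, Finset.prod_const, Finset.card_univ, Fintype.card_fin,
    Finset.prod_univ_sum, Finset.mul_sum]
  apply Finset.sum_congr rfl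
  intro m _
  rw [Finset.prod_mul_distrib, inv_pow, ← pow_mul]
  simp only [walshValD, walshD, cubePoint]
  ring

/-- `a` is the sequence of coefficients of the restricted measure. -/
def HasCoef {d : ℕ} (r : ℕ) (c : Fin d → ℕ) (e : Fin d → ℕ → ℕ → ℕ)
    (a : (Fin d → ℕ) → ℂ) : Prop :=
  ∀ n L, r ≤ 2 * MM L → (∀ l, n l < 2 ^ (2 * MM L)) → a n = (coef r c e L n : ℝ)

lemma coef_succ {d : ℕ} (hd : 0 < d) {r : ℕ} (c : Fin d → ℕ) {e : Fin d → ℕ → ℕ → ℕ}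
    (he : ∀ l, Adm (e l)) {L : ℕ} (hr : r ≤ 2 * MM L) {n : Fin d → ℕ}
    (hn : ∀ l, n l < 2 ^ (2 * MM L)) : coef r c e (L + 1) n = coef r c e L n := by
  unfold coef
  have hstep : 2 * MM L + 1 ≤ MM (L + 1) := MM_step (Nat.lt_succ_self L)
  rw [Finset.range_add_one, Finset.sum_powerset_insert (by simp)]
  have h2 : ∑ A ∈ (Finset.range L).powerset, ∏ l, avg (2 * MM (L + 1))
      (fun y => walsh (n l) y * fA r (c l) (e l) (insert L A) y) = 0 := by
    apply Finset.sum_eq_zero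
    intro A hA
    have hLA : L ∉ A := fun h => by simpa using Finset.mem_powerset.mp hA h
    apply Finset.prod_eq_zero (Finset.mem_univ (⟨0, hd⟩ : Fin d))
    rw [fA_insert _ _ _ hLA]
    have : (fun y => walsh (n ⟨0, hd⟩) y *
        (fA r (c ⟨0, hd⟩) (e ⟨0, hd⟩) A y * Rw (MM L) (e ⟨0, hd⟩ L) y)) =
        fun y => walsh (n ⟨0, hd⟩) y * (walsh (2 ^ (2 * MM L)) y *
          (fun y => fA r (c ⟨0, hd⟩) (e ⟨0, hd⟩) A y *
            walsh (2 ^ MM L * e ⟨0, hd⟩ L (idx (MM L) y)) y) y) := by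
      funext y
      rw [Rw_factor (he _ L).1]
      ring
    rw [this]
    exact coeff_high ((fA_dep_range (he _) (Finset.mem_powerset.mp hA) hr).mul
      (Rw_tail_dep (he _ L).1)) (by omega) (hn _)
  rw [h2, add_zero]
  apply Finset.sum_congr rfl
  intro A hA
  apply Finset.prod_congr rfl
  intro l _
  exact coeff_indep (fA_dep_range (he l) (Finset.mem_powerset.mp hA) hr) (by omega) le_rfl (hn l)

lemma exists_hasCoef {d : ℕ} (hd : 0 < d) (r : ℕ) (c : Fin d → ℕ) {e : Fin d → ℕ → ℕ → ℕ}
    (he : ∀ l, Adm (e l)) : ∃ a : (Fin d → ℕ) → ℂ, HasCoef r c e a := by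
  have key : ∀ n : Fin d → ℕ, ∀ L L', L ≤ L' → r ≤ 2 * MM L → (∀ l, n l < 2 ^ (2 * MM L)) →
      coef r c e L' n = coef r c e L n := by
    intro n L L' hLL hr hn
    induction L', hLL using Nat.le_induction with
    | base => rfl
    | succ L' h ih =>
      have hm := MM_mono h
      rw [coef_succ hd c he (by omega) (fun l => (hn l).trans_le (pow_two_le (by omega))), ih]
  refine ⟨fun n => (coef r c e (r + ∑ l, n l) n : ℝ), ?_⟩
  intro n L hr hn
  have h1 : r ≤ 2 * MM (r + ∑ l, n l) := by have := MM_ge (r + ∑ l, n l); omega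
  have h2 : ∀ l, n l < 2 ^ (2 * MM (r + ∑ l, n l)) := by
    intro l
    have h3 : n l ≤ ∑ l, n l := Finset.single_le_sum (fun _ _ => Nat.zero_le _) (Finset.mem_univ l)
    have h4 := MM_ge (r + ∑ l, n l)
    exact lt_of_lt_of_le (Nat.lt_two_pow_self) (pow_two_le (by omega))
  rcases le_total L (r + ∑ l, n l) with h | h
  · simp only; rw [key n _ _ h hr hn]
  · simp only; rw [key n _ _ h h1 h2]

lemma hasCoef_rows {d : ℕ} {r : ℕ} {c : Fin d → ℕ} {e : Fin d → ℕ → ℕ → ℕ}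
    (he : ∀ l, Adm (e l)) {a : (Fin d → ℕ) → ℂ} (ha : HasCoef r c e a) (K : ℕ) :
    ∃ B, ∀ n, a n ≠ 0 → (∃ j, n j ≤ K) → ∀ i, n i ≤ B := by
  set s := r + K with hs
  have hge := MM_ge s
  refine ⟨2 ^ (2 * MM s), ?_⟩
  rintro n hn ⟨j, hj⟩ i
  set L := s + ∑ l, n l with hL
  have h4 := MM_ge L
  have hLs := MM_mono (show s ≤ L by omega)
  have h2 : ∀ l, n l < 2 ^ (2 * MM L) := by
    intro l
    have h3 : n l ≤ ∑ l, n l := Finset.single_le_sum (fun _ _ => Nat.zero_le _) (Finset.mem_univ l)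
    exact lt_of_lt_of_le (Nat.lt_two_pow_self) (pow_two_le (by omega))
  rw [ha n L (by omega) h2] at hn
  have hn : coef r c e L n ≠ 0 := by exact_mod_cast hn
  obtain ⟨A, hA, hA0⟩ := Finset.exists_ne_zero_of_sum_ne_zero hn
  rw [Finset.prod_ne_zero_iff] at hA0
  have hAL := Finset.mem_powerset.mp hA
  by_cases hAs : A ⊆ Finset.range s
  · by_contra hlt
    refine hA0 i (Finset.mem_univ i) ?_
    exact coeff_low (fA_dep_range (he i) hAs (by omega)) (by omega) (h2 i) (by omega)
  · exfalso
    obtain ⟨i', hi'A, hi', h, hh, hfh⟩ := fA_high (r := r) (c := c j) (he j) hAs (by omega)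
    refine hA0 j (Finset.mem_univ j) ?_
    rw [hfh]
    have := MM_step (Finset.mem_range.mp (hAL hi'A))
    have h5 := MM_mono hi'
    refine coeff_high hh (by omega) ?_
    refine lt_of_lt_of_le (Nat.lt_two_pow_self) (pow_two_le ?_)
    omega

lemma partialSum_eq {d : ℕ} {r : ℕ} {c : Fin d → ℕ} {e : Fin d → ℕ → ℕ → ℕ}
    {a : (Fin d → ℕ) → ℂ} (ha : HasCoef r c e a) {L : ℕ} (hr : r ≤ 2 * MM L)
    {N : Fin d → ℕ} (hN : ∀ l, N l ≤ 2 ^ (2 * MM L)) (g : GD d) :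
    walshPartialSum a N g = ((∑ A ∈ (Finset.range L).powerset,
      ∏ l, SN (2 * MM L) (N l) (fA r (c l) (e l) A) (g l) : ℝ) : ℂ) := by
  have : walshPartialSum a N g = ((∑ n ∈ boxLt N, coef r c e L n * walshD n g : ℝ) : ℂ) := by
    unfold walshPartialSum
    push_cast
    apply Finset.sum_congr rfl
    intro n hn
    rw [ha n L hr]
    intro l
    have := Finset.mem_range.mp (Fintype.mem_piFinset.mp hn l)
    exact lt_of_lt_of_le this (hN l)
  rw [this]
  congr 1
  simp only [coef, Finset.sum_mul]
  rw [Finset.sum_comm]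
  apply Finset.sum_congr rfl
  intro A _
  unfold SN
  rw [Finset.prod_univ_sum]
  apply Finset.sum_congr rfl
  intro n _
  rw [walshD, ← Finset.prod_mul_distrib]

lemma prod_diff_bound {ι : Type*} (s : Finset ι) (a b : ι → ℝ) (δ : ℝ) (hδ : 0 ≤ δ)
    (ha : ∀ i, |a i| ≤ 3) (hb : ∀ i, |b i| ≤ 3) (hab : ∀ i, |a i - b i| ≤ δ) :
    |∏ i ∈ s, a i - ∏ i ∈ s, b i| ≤ s.card * 3 ^ s.card * δ := by
  induction s using Finset.induction_on with
  | empty => simp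
  | insert i s hi ih =>
    rw [Finset.prod_insert hi, Finset.prod_insert hi, Finset.card_insert_of_notMem hi]
    have hB : |∏ i ∈ s, b i| ≤ 3 ^ s.card := by
      rw [Finset.abs_prod]
      calc ∏ i ∈ s, |b i| ≤ ∏ i ∈ s, (3 : ℝ) :=
            Finset.prod_le_prod (fun _ _ => abs_nonneg _) (fun i _ => hb i)
        _ = 3 ^ s.card := by simp
    have e1 : a i * ∏ i ∈ s, a i - b i * ∏ i ∈ s, b i =
        a i * (∏ i ∈ s, a i - ∏ i ∈ s, b i) + (a i - b i) * ∏ i ∈ s, b i := by ring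
    rw [e1]
    refine (abs_add_le _ _).trans ?_
    rw [abs_mul, abs_mul]
    have t1 : |a i| * |∏ i ∈ s, a i - ∏ i ∈ s, b i| ≤ 3 * (s.card * 3 ^ s.card * δ) :=
      mul_le_mul (ha i) ih (abs_nonneg _) (by norm_num)
    have t2 : |a i - b i| * |∏ i ∈ s, b i| ≤ δ * 3 ^ s.card :=
      mul_le_mul (hab i) hB (abs_nonneg _) hδ
    have t3 : (0 : ℝ) ≤ δ * 3 ^ s.card := by positivity
    push_cast
    rw [pow_succ]
    nlinarith

lemma abs_le_three {u v p : ℝ} (h1 : |u - v| ≤ p) (h2 : |v| ≤ 2) (h3 : p ≤ 1) : |u| ≤ 3 := by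
  have h1 := abs_le.mp h1
  have h2 := abs_le.mp h2
  exact abs_le.mpr ⟨by linarith, by linarith⟩

set_option maxHeartbeats 1000000 in
lemma main_bound {d : ℕ} {r : ℕ} {c : Fin d → ℕ} {e : Fin d → ℕ → ℕ → ℕ}
    (he : ∀ l, Adm (e l)) {a : (Fin d → ℕ) → ℂ} (ha : HasCoef r c e a) (g : GD d) (t : ℕ)
    (hr : r ≤ 2 * MM t + 1) (hg : densF r c e (Finset.range (t + 1)) g = 0)
    {N : Fin d → ℕ} (hN : ∀ l, 2 ^ (2 * MM (t + 1)) < N l)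
    (hN' : ∃ l, N l ≤ 2 ^ (2 * MM (t + 2))) :
    ‖walshPartialSum a N g‖ ≤ 2 ^ (t + 1) * (d * 3 ^ d * ((2 : ℝ) ^ (2 * MM t + 1))⁻¹) := by
  obtain ⟨l0, hl0⟩ := hN'
  set L := t + 2 + ∑ l, N l with hL
  have hLM := MM_ge L
  have hML := MM_mono (show t + 2 ≤ L by omega)
  have h12 := MM_step (show t + 1 < t + 2 by omega)
  have h01 := MM_step (show t < t + 1 by omega)
  have hNL : ∀ l, N l ≤ 2 ^ (2 * MM L) := by
    intro l
    have h3 : N l ≤ ∑ l, N l := Finset.single_le_sum (fun _ _ => Nat.zero_le _) (Finset.mem_univ l)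
    exact (Nat.lt_two_pow_self).le.trans (pow_two_le (by omega))
  rw [partialSum_eq ha (L := L) (by omega) hNL g, Complex.norm_real, Real.norm_eq_abs]
  have step1 : ∑ A ∈ (Finset.range L).powerset,
      ∏ l, SN (2 * MM L) (N l) (fA r (c l) (e l) A) (g l) =
      ∑ A ∈ (Finset.range (t + 1 + 1)).powerset,
        ∏ l, SN (2 * MM L) (N l) (fA r (c l) (e l) A) (g l) := by
    symm
    apply Finset.sum_subset
    · apply Finset.powerset_mono.mpr
      intro i; simp only [Finset.mem_range]; omega
    · intro A hA hA'
      rw [Finset.mem_powerset] at hA hA'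
      apply Finset.prod_eq_zero (Finset.mem_univ l0)
      obtain ⟨i, hiA, hi, h, hh, hfh⟩ := fA_high (r := r) (c := c l0) (he l0) hA' (by
        show r ≤ 2 * MM (t + 2); omega)
      rw [hfh]
      have h1 := MM_step (Finset.mem_range.mp (hA hiA))
      have h2 := MM_mono hi
      exact SN_high hh (by omega) (hl0.trans (pow_two_le (by
        have : MM (t + 2) ≤ MM i := h2
        omega))) _
  rw [step1, Finset.range_add_one, Finset.sum_powerset_insert (by simp)]
  have step2 : ∑ A ∈ (Finset.range (t + 1)).powerset,
      ∏ l, SN (2 * MM L) (N l) (fA r (c l) (e l) A) (g l) = 0 := by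
    rw [← hg, densF_expand]
    apply Finset.sum_congr rfl
    intro A hA
    apply Finset.prod_congr rfl
    intro l _
    exact SN_low (fA_dep_range (he l) (Finset.mem_powerset.mp hA) (by omega)) (hN l).le (hNL l) _
  rw [step2, zero_add]
  choose θ hθ2 hθ using fun l => key_estimate (p := 2 * MM t + 1) (MM_succ t) (he l (t + 1)).1
    (he l (t + 1)).2 (N l) (g l)
  have step3 : ∑ A ∈ (Finset.range (t + 1)).powerset,
      ∏ l, (fA r (c l) (e l) A (g l) * θ l) = 0 := by
    simp only [Finset.prod_mul_distrib]
    rw [← Finset.sum_mul, ← densF_expand, hg, zero_mul]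
  rw [← sub_zero (∑ A ∈ _, _), ← step3, ← Finset.sum_sub_distrib]
  refine (Finset.abs_sum_le_sum_abs _ _).trans ?_
  have hp1 : ((2 : ℝ) ^ (2 * MM t + 1))⁻¹ ≤ 1 := inv_le_one_of_one_le₀ (one_le_pow₀ (by norm_num))
  have each : ∀ A ∈ (Finset.range (t + 1)).powerset,
      |∏ l, SN (2 * MM L) (N l) (fA r (c l) (e l) (insert (t + 1) A)) (g l) -
        ∏ l, (fA r (c l) (e l) A (g l) * θ l)| ≤
        d * 3 ^ d * ((2 : ℝ) ^ (2 * MM t + 1))⁻¹ := by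
    intro A hA
    have hA := Finset.mem_powerset.mp hA
    have hnot : t + 1 ∉ A := fun h => by simpa using hA h
    have hdep : ∀ l, Dep (2 * MM t + 1) (fA r (c l) (e l) A) := by
      intro l
      apply fA_dep (he l) _ hr
      intro i hi
      have := Finset.mem_range.mp (hA hi)
      have := MM_mono (show i ≤ t by omega)
      omega
    have hd1 : ∀ l, |SN (2 * MM L) (N l) (fA r (c l) (e l) (insert (t + 1) A)) (g l) -
        fA r (c l) (e l) A (g l) * θ l| ≤ ((2 : ℝ) ^ (2 * MM t + 1))⁻¹ := by
      intro l
      rw [fA_insert _ _ _ hnot]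
      exact hθ l _ (by omega) (hNL l) _ (hdep l) (fA_abs _ _ _ _)
    have hb : ∀ l, |fA r (c l) (e l) A (g l) * θ l| ≤ 2 := by
      intro l
      rw [abs_mul]
      exact (mul_le_mul (fA_abs r (c l) (e l) A (g l)) (hθ2 l) (abs_nonneg _)
        zero_le_one).trans_eq (one_mul _)
    have ha3 : ∀ l, |SN (2 * MM L) (N l) (fA r (c l) (e l) (insert (t + 1) A)) (g l)| ≤ 3 := by
      intro l
      exact abs_le_three (hd1 l) (hb l) hp1
    have hfin := prod_diff_bound Finset.univ
      (fun l => SN (2 * MM L) (N l) (fA r (c l) (e l) (insert (t + 1) A)) (g l))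
      (fun l => fA r (c l) (e l) A (g l) * θ l) _ (by positivity) ha3
      (fun l => (hb l).trans (by norm_num)) hd1
    rw [Finset.card_univ, Fintype.card_fin] at hfin
    exact hfin
  refine (Finset.sum_le_sum each).trans ?_
  rw [Finset.sum_const, Finset.card_powerset, Finset.card_range, nsmul_eq_mul]
  push_cast
  exact le_rfl

lemma main_conv {d : ℕ} (hd : 0 < d) {r : ℕ} {c : Fin d → ℕ} {e : Fin d → ℕ → ℕ → ℕ}
    (he : ∀ l, Adm (e l)) {a : (Fin d → ℕ) → ℂ} (ha : HasCoef r c e a) (g : GD d)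
    (hg : g ∉ dyadicCube r c ∨ ∃ i, Rd e i g ≠ 1) : ConvergesOverRectangles a g 0 := by
  have hR : ∀ i, Rd e i g = 1 ∨ Rd e i g = -1 := by
    intro i
    have : |Rd e i g| = 1 := by
      unfold Rd; rw [Finset.abs_prod]; simp [Rw_abs]
    exact eq_or_eq_neg_of_abs_eq this
  obtain ⟨s1, hs1⟩ : ∃ s1, ∀ s, s1 ≤ s → densF r c e (Finset.range (s + 1)) g = 0 := by
    rcases hg with hg | ⟨i, hi⟩
    · exact ⟨0, fun s _ => by simp [densF, hg]⟩
    · refine ⟨i, fun s hs => ?_⟩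
      unfold densF
      rw [Finset.prod_eq_zero (i := i), mul_zero]
      · rw [Finset.mem_range]; omega
      · rw [(hR i).resolve_left hi]; norm_num
  unfold ConvergesOverRectangles
  rw [Metric.tendsto_atTop]
  intro ε hε
  have hlim : Tendsto (fun t : ℕ => (d * 3 ^ d : ℝ) * (1 / 2 : ℝ) ^ t) atTop (𝓝 0) := by
    have := (tendsto_pow_atTop_nhds_zero_of_lt_one (r := (1 / 2 : ℝ)) (by norm_num)
      (by norm_num)).const_mul (d * 3 ^ d : ℝ)
    simpa using this
  obtain ⟨t1, ht1⟩ := Filter.eventually_atTop.mp (hlim.eventually (gt_mem_nhds hε))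
  set t0 := t1 + s1 + r with ht0
  refine ⟨fun _ => 2 ^ (2 * MM (t0 + 1)) + 1, fun N hN => ?_⟩
  have hN : ∀ l, 2 ^ (2 * MM (t0 + 1)) < N l := fun l => hN l
  have hex : ∃ s, ¬ ∀ l, 2 ^ (2 * MM s) < N l := by
    refine ⟨N ⟨0, hd⟩, fun h => ?_⟩
    have h1 := h ⟨0, hd⟩
    have h2 := MM_ge (N ⟨0, hd⟩)
    have h3 : N ⟨0, hd⟩ < 2 ^ (2 * MM (N ⟨0, hd⟩)) :=
      lt_of_lt_of_le Nat.lt_two_pow_self (pow_two_le (by omega))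
    omega
  set s' := Nat.find hex with hs'
  have hbig : t0 + 1 < s' := by
    by_contra hle
    refine Nat.find_spec hex fun l => lt_of_le_of_lt (pow_two_le ?_) (hN l)
    have := MM_mono (show Nat.find hex ≤ t0 + 1 by omega)
    omega
  obtain ⟨t, ht⟩ : ∃ t, s' = t + 2 := ⟨s' - 2, by omega⟩
  have hlow : ∀ l, 2 ^ (2 * MM (t + 1)) < N l := by
    have := Nat.find_min hex (m := t + 1) (by omega)
    push Not at this
    exact this
  have hup : ∃ l, N l ≤ 2 ^ (2 * MM (t + 2)) := by
    have := Nat.find_spec hex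
    rw [← hs', ht] at this
    push Not at this
    exact this
  have hMt := MM_ge t
  have hb := main_bound he ha g t (by omega) (hs1 t (by omega)) hlow hup
  rw [dist_zero_right]
  refine lt_of_le_of_lt (hb.trans ?_) (ht1 t (by omega))
  have hpow : ((2 : ℝ) ^ (2 * MM t + 1))⁻¹ ≤ ((2 : ℝ) ^ (2 * t + 1))⁻¹ :=
    inv_anti₀ (by positivity) (pow_le_pow_right₀ (by norm_num) (by omega))
  calc (2 : ℝ) ^ (t + 1) * (d * 3 ^ d * ((2 : ℝ) ^ (2 * MM t + 1))⁻¹)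
      ≤ (2 : ℝ) ^ (t + 1) * (d * 3 ^ d * ((2 : ℝ) ^ (2 * t + 1))⁻¹) := by gcongr
    _ = d * 3 ^ d * (1 / 2) ^ t := by
      rw [show 2 * t + 1 = t + (t + 1) by ring, pow_add, one_div, inv_pow]
      field_simp
      ring


/-! ### Iterated convergence -/

/-- Partial sums in the variables of the list `l`. -/
def PS {d : ℕ} : List (Fin d) → (Fin d → ℕ) → ((Fin d → ℕ) → ℂ) → ((Fin d → ℕ) → ℂ)
  | [], _, f => f
  | j :: rest, N, f => PS rest N (fun n => ∑ t ∈ Finset.range (N j), f (Function.update n j t))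

lemma PS_eq {d : ℕ} (l : List (Fin d)) (hl : l.Nodup) (N : Fin d → ℕ) :
    ∀ (f : (Fin d → ℕ) → ℂ) (n : Fin d → ℕ), PS l N f n =
      ∑ x ∈ Fintype.piFinset (fun i => if i ∈ l then Finset.range (N i) else {n i}), f x := by
  induction l with
  | nil =>
    intro f n
    simp [PS, Fintype.piFinset_singleton]
  | cons j rest ih =>
    intro f n
    obtain ⟨hj, hrest⟩ := List.nodup_cons.mp hl
    rw [PS, ih hrest, Finset.sum_sigma']
    refine Finset.sum_nbij' (fun p => Function.update p.1 j p.2)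
      (fun y => ⟨Function.update y j (n j), y j⟩) ?_ ?_ ?_ ?_ ?_
    · rintro ⟨x, t⟩ h
      simp only [Finset.mem_sigma, Fintype.mem_piFinset] at h ⊢
      intro i
      by_cases hij : i = j
      · subst hij; simpa using h.2
      · have := h.1 i
        simpa [hij] using this
    · intro y h
      simp only [Finset.mem_sigma, Fintype.mem_piFinset] at h ⊢
      constructor
      · intro i
        by_cases hij : i = j
        · subst hij; simp [hj]
        · have := h i
          simpa [hij] using this
      · simpa using h j
    · rintro ⟨x, t⟩ h
      simp only [Finset.mem_sigma, Fintype.mem_piFinset] at h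
      have := h.1 j
      simp only [hj, if_false, Finset.mem_singleton] at this
      simp [← this]
    · intro y h
      simp
    · rintro ⟨x, t⟩ h
      rfl

lemma PS_congr {d : ℕ} {l : List (Fin d)} (hl : l.Nodup) {N N' : Fin d → ℕ}
    (hN : ∀ i ∈ l, N i = N' i) {f f' : (Fin d → ℕ) → ℂ} (n : Fin d → ℕ)
    (hf : ∀ x, (∀ i ∈ l, x i < N i) → f x = f' x) : PS l N f n = PS l N' f' n := by
  rw [PS_eq l hl, PS_eq l hl]
  have : (fun i => if i ∈ l then Finset.range (N i) else {n i}) =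
      (fun i => if i ∈ l then Finset.range (N' i) else {n i}) := by
    funext i
    split_ifs with h
    · rw [hN i h]
    · rfl
  rw [← this]
  apply Finset.sum_congr rfl
  intro x hx
  apply hf
  intro i hi
  have := Fintype.mem_piFinset.mp hx i
  simpa [hi] using this

lemma iter_conv {d : ℕ} : ∀ (l : List (Fin d)), l.Nodup → l ≠ [] → ∀ f : (Fin d → ℕ) → ℂ,
    (∀ K, ∃ M, ∀ n, f n ≠ 0 → (∃ i ∈ l, n i ≤ K) → ∀ j ∈ l, n j ≤ M) →
    (∀ n, ∀ ε > (0 : ℝ), ∃ K, ∀ N : Fin d → ℕ, (∀ i ∈ l, K ≤ N i) → ‖PS l N f n‖ < ε) →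
    IterConverges l f 0 := by
  intro l
  induction l with
  | nil => intro _ h; exact absurd rfl h
  | cons j rest ih =>
    intro hl _ f hQ hC
    obtain ⟨hj, hrest⟩ := List.nodup_cons.mp hl
    cases hr : rest with
    | nil =>
      subst hr
      refine ⟨fun _ => 0, ⟨fun _ => 0, ?_, rfl⟩, fun _ => rfl⟩
      intro n
      rw [Metric.tendsto_atTop]
      intro ε hε
      obtain ⟨K, hK⟩ := hC n ε hε
      refine ⟨K, fun T hT => ?_⟩
      rw [dist_zero_right]
      exact hK (fun _ => T) (fun _ _ => hT)
    | cons k rest' =>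
      rw [← hr]
      have hk : k ∈ rest := by rw [hr]; simp
      have hkj : k ≠ j := fun h => hj (h ▸ hk)
      choose M hM using hQ
      have hfin : ∀ n t, M (n k) < t → f (Function.update n j t) = 0 := by
        intro n t ht
        by_contra hne
        have := hM (n k) _ hne ⟨k, List.mem_cons_of_mem _ hk, by simp [hkj]⟩ j (by simp)
        simp at this
        omega
      have hsum : ∀ n T, M (n k) + 1 ≤ T →
          ∑ t ∈ Finset.range T, f (Function.update n j t) =
          ∑ t ∈ Finset.range (M (n k) + 1), f (Function.update n j t) := by
        intro n T hT
        symm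
        apply Finset.sum_subset
        · exact Finset.range_mono hT
        · intro t _ ht
          apply hfin
          simp only [Finset.mem_range, not_lt] at ht
          omega
      set h : (Fin d → ℕ) → ℂ := fun n =>
        ∑ t ∈ Finset.range (M (n k) + 1), f (Function.update n j t) with hh
      obtain ⟨g, hg1, hg2⟩ := ih hrest (by rw [hr]; simp) h (by
        intro K
        refine ⟨M K, ?_⟩
        rintro n hn ⟨i, hi, hiK⟩ j' hj'
        obtain ⟨t, _, ht⟩ := Finset.exists_ne_zero_of_sum_ne_zero hn
        have hij : i ≠ j := fun h => hj (h ▸ hi)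
        have hij' : j' ≠ j := fun h => hj (h ▸ hj')
        have := hM K _ ht ⟨i, List.mem_cons_of_mem _ hi, by simpa [hij] using hiK⟩ j'
          (List.mem_cons_of_mem _ hj')
        simpa [hij'] using this) (by
        intro n ε hε
        obtain ⟨K, hK⟩ := hC n ε hε
        refine ⟨K, fun N hN => ?_⟩
        set B := K + ∑ v ∈ Finset.range (N k), (M v + 1) with hB
        have := hK (Function.update N j B) (by
          intro i hi
          by_cases hij : i = j
          · subst hij; simp [hB]
          · simp only [ne_eq, hij, not_false_eq_true, Function.update_of_ne]
            exact hN i ((List.mem_cons.mp hi).resolve_left hij))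
        rw [PS] at this
        rw [PS_congr (N' := Function.update N j B) hrest ?_ n ?_]
        · exact this
        · intro i hi
          have hij : i ≠ j := fun h => hj (h ▸ hi)
          simp [hij]
        · intro x hx
          simp only [hh, Function.update_self]
          symm
          apply hsum
          have : M (x k) + 1 ≤ ∑ v ∈ Finset.range (N k), (M v + 1) :=
            Finset.single_le_sum (f := fun v => M v + 1) (fun _ _ => Nat.zero_le _)
              (Finset.mem_range.mpr (hx k hk))
          omega)
      refine ⟨g, ⟨h, ?_, hg1⟩, hg2⟩
      intro n
      apply tendsto_atTop_of_eventually_const (i₀ := M (n k) + 1)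
      intro T hT
      exact hsum n T hT

lemma iter_of_rect {d : ℕ} (hd : 0 < d) {r : ℕ} {c : Fin d → ℕ} {e : Fin d → ℕ → ℕ → ℕ}
    (he : ∀ l, Adm (e l)) {a : (Fin d → ℕ) → ℂ} (ha : HasCoef r c e a) (g : GD d)
    (hg : ConvergesOverRectangles a g 0) (l : List (Fin d)) (hl : l.Nodup)
    (hfull : ∀ j, j ∈ l) : IterConverges l (fun n => a n * (walshD n g : ℂ)) 0 := by
  apply iter_conv l hl
  · intro h
    have := hfull ⟨0, hd⟩
    rw [h] at this
    simp at this
  · intro K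
    obtain ⟨B, hB⟩ := hasCoef_rows he ha K
    refine ⟨B, ?_⟩
    rintro n hn ⟨i, _, hi⟩ j _
    exact hB n (left_ne_zero_of_mul hn) ⟨i, hi⟩ j
  · intro n ε hε
    unfold ConvergesOverRectangles at hg
    rw [Metric.tendsto_atTop] at hg
    obtain ⟨N0, hN0⟩ := hg ε hε
    refine ⟨∑ i, N0 i, fun N hN => ?_⟩
    have := hN0 N (fun i => (Finset.single_le_sum (f := N0) (fun _ _ => Nat.zero_le _)
      (Finset.mem_univ i)).trans (hN i (hfull i)))
    rw [dist_zero_right] at this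
    rw [PS_eq l hl]
    simp only [hfull, if_true]
    exact this


/-! ### The set `F^π` -/

/-- The shift by `n` places. -/
def shiftG (n : ℕ) (x : DyadicGroup) : DyadicGroup := fun t => x (n + t)

lemma idx_add (n k : ℕ) (x : DyadicGroup) :
    idx (n + k) x = 2 ^ k * idx n x + idx k (shiftG n x) := by
  induction k with
  | zero => simp [idx]
  | succ k ih =>
    rw [← add_assoc, idx, ih, idx, pow_succ]
    simp only [shiftG]
    ring_nf

lemma walsh_shift (n q : ℕ) (x : DyadicGroup) : walsh (2 ^ n * q) x = walsh q (shiftG n x) := by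
  have hq : q < 2 ^ q := Nat.lt_two_pow_self
  have h1 : 2 ^ n * q < 2 ^ (n + q) := by
    rw [pow_add]; exact Nat.mul_lt_mul_of_pos_left hq (by positivity)
  rw [walsh_eq h1, walsh_eq hq, Finset.prod_range_add, Finset.prod_eq_one, one_mul]
  · apply Finset.prod_congr rfl
    intro t _
    simp [Nat.testBit_two_pow_mul, shiftG]
    congr
  · intro t ht
    have := Finset.mem_range.mp ht
    have h2 : ¬ n ≤ t := by omega
    simp [Nat.testBit_two_pow_mul, h2]

lemma mem_Fspi {d : ℕ} (π : ℕ → (Fin d → ℕ) → Fin d → ℕ) (s : ℕ) (g : GD d) :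
    g ∈ Fspi π s ↔ walshD (fun _ => 2 ^ (2 * mSeq s)) g =
      walshValD (mSeq s) (π s (fun l => idx (mSeq s) (g l)))
        (fun l => idx (mSeq s) (shiftG (mSeq s) (g l))) := by
  unfold Fspi
  simp only [Set.mem_iUnion]
  generalize hn : mSeq s = n
  have hpos : 0 < 2 ^ n := by positivity
  constructor
  · rintro ⟨m, hm, m', hm', hg, hw⟩
    have hmm : ∀ l, idx n (g l) = m l ∧ idx n (shiftG n (g l)) = m' l := by
      intro l
      have h1 := hg l
      have hm1 : m l < 2 ^ n := hm l
      have hm2 : m' l < 2 ^ n := hm' l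
      rw [mem_interval_iff (by
        rw [two_mul, pow_add]
        nlinarith), two_mul, idx_add] at h1
      have h3 := idx_lt n (shiftG n (g l))
      have h4 : idx n (g l) = m l := by
        have := congrArg (· / 2 ^ n) h1
        simpa [Nat.mul_add_div hpos, Nat.div_eq_of_lt h3, Nat.div_eq_of_lt hm2] using this
      rw [h4] at h1
      exact ⟨h4, Nat.add_left_cancel h1⟩
    have e1 : (fun l => idx n (g l)) = m := funext fun l => (hmm l).1
    have e2 : (fun l => idx n (shiftG n (g l))) = m' := funext fun l => (hmm l).2
    rw [e1, e2]
    exact hw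
  · intro h
    refine ⟨_, fun l => idx_lt n (g l), _, fun l => idx_lt n (shiftG n (g l)), ?_, h⟩
    intro l
    have := mem_interval_idx (n + n) (g l)
    rw [idx_add, ← two_mul] at this
    exact this

lemma exists_adm {d : ℕ} (π : PermSeq d) (hπ : π.Coordinatewise) :
    ∃ e : Fin d → ℕ → ℕ → ℕ, (∀ l, Adm (e l)) ∧
      ∀ g : GD d, g ∈ Fpi π.f ↔ ∀ s, Rd e s g = 1 := by
  choose e he using hπ
  have hadm : ∀ l, Adm (fun s => e (s + 1) l) := by
    intro l s
    constructor
    · intro a ha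
      have h1 := π.maps (s + 1) (show (fun _ => a) ∈ box d (mSeq (s + 1)) from fun _ => ha) l
      rw [he] at h1
      exact h1
    · intro a _ b _ hab
      have h2 : (Function.update (fun _ => 0) l a : Fin d → ℕ) =
          Function.update (fun _ => 0) l b := by
        apply (π.p (s + 1)).injective
        rw [he, he]
        funext l'
        by_cases h : l' = l
        · subst h; simpa using hab
        · simp [h]
      simpa using congrFun h2 l
  refine ⟨fun l s => e (s + 1) l, hadm, ?_⟩
  intro g
  have hs : ∀ s, g ∈ Fspi π.f (s + 1) ↔ Rd (fun l s => e (s + 1) l) s g = 1 := by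
    intro s
    rw [mem_Fspi]
    have hA : walshD (fun _ => 2 ^ (2 * mSeq (s + 1))) g = ∏ l, walsh (2 ^ (2 * MM s)) (g l) := rfl
    have hB : walshValD (mSeq (s + 1)) (π.f (s + 1) (fun l => idx (mSeq (s + 1)) (g l)))
        (fun l => idx (mSeq (s + 1)) (shiftG (mSeq (s + 1)) (g l))) =
        ∏ l, walsh (2 ^ MM s * e (s + 1) l (idx (MM s) (g l))) (g l) := by
      unfold walshValD walshD
      apply Finset.prod_congr rfl
      intro l _
      have : π.f (s + 1) (fun l => idx (mSeq (s + 1)) (g l)) l =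
          e (s + 1) l (idx (MM s) (g l)) := by
        unfold PermSeq.f; rw [he]; rfl
      rw [this, walsh_shift]
      refine walsh_dep ((hadm l s).1 _ (idx_lt _ _)) _ _ ?_
      exact pt_idx_agree _ _
    have hR : Rd (fun l s => e (s + 1) l) s g = (∏ l, walsh (2 ^ (2 * MM s)) (g l)) *
        ∏ l, walsh (2 ^ MM s * e (s + 1) l (idx (MM s) (g l))) (g l) := by
      unfold Rd
      rw [← Finset.prod_mul_distrib]
      apply Finset.prod_congr rfl
      intro l _
      exact Rw_factor (hadm l s).1 _
    rw [hA, hB, hR]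
    have hc : ∀ n : Fin d → ℕ, (∏ l, walsh (n l) (g l)) = 1 ∨ (∏ l, walsh (n l) (g l)) = -1 := by
      intro n
      apply eq_or_eq_neg_of_abs_eq
      rw [Finset.abs_prod]
      simp [walsh_abs]
    rcases hc (fun _ => 2 ^ (2 * MM s)) with h1 | h1 <;>
    rcases hc (fun l => 2 ^ MM s * e (s + 1) l (idx (MM s) (g l))) with h2 | h2 <;>
    simp only [h1, h2] <;> norm_num
  unfold Fpi
  simp only [Set.mem_iInter, Set.mem_Ici]
  constructor
  · intro h s
    exact (hs s).mp (h (s + 1) (by omega))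
  · intro h s h1
    obtain ⟨t, rfl⟩ : ∃ t, s = t + 1 := ⟨s - 1, by omega⟩
    exact (hs t).mpr (h t)

lemma Rd_dep {d : ℕ} {e : Fin d → ℕ → ℕ → ℕ} (he : ∀ l, Adm (e l)) {i : ℕ} {g g' : GD d}
    (h : ∀ l, ∀ t < 2 * MM i + 1, g l t = g' l t) : Rd e i g = Rd e i g' := by
  unfold Rd
  apply Finset.prod_congr rfl
  intro l _
  exact Rw_dep (he l i).1 _ _ (h l)

lemma Rd_cases {d : ℕ} (e : Fin d → ℕ → ℕ → ℕ) (i : ℕ) (g : GD d) :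
    Rd e i g = 1 ∨ Rd e i g = -1 := by
  have : |Rd e i g| = 1 := by
    unfold Rd; rw [Finset.abs_prod]; simp [Rw_abs]
  exact eq_or_eq_neg_of_abs_eq this

/-- Flip the `k`-th digit of the `l`-th coordinate. -/
def flipG {d : ℕ} (l : Fin d) (k : ℕ) (g : GD d) : GD d :=
  Function.update g l (Function.update (g l) k (g l k + 1))

lemma flipG_ne {d : ℕ} (l : Fin d) (k : ℕ) (g : GD d) (l' : Fin d) {t : ℕ} (ht : t ≠ k) :
    flipG l k g l' t = g l' t := by
  unfold flipG
  by_cases h : l' = l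
  · subst h; simp [ht]
  · simp [h]

lemma Rd_flip {d : ℕ} {e : Fin d → ℕ → ℕ → ℕ} (he : ∀ l, Adm (e l)) (l : Fin d) (i : ℕ)
    (g : GD d) : Rd e i (flipG l (2 * MM i) g) = - Rd e i g := by
  unfold Rd
  rw [← Finset.mul_prod_erase _ _ (Finset.mem_univ l),
    ← Finset.mul_prod_erase (s := Finset.univ) (f := fun l => Rw (MM i) (e l i) (g l))
      (h := Finset.mem_univ l), ← neg_mul]
  congr 1
  · have htail := Rw_tail_dep (he l i).1 (flipG l (2 * MM i) g l) (g l)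
        (fun t ht => flipG_ne _ _ _ _ (by omega))
    simp only at htail
    rw [Rw_factor (he l i).1, Rw_factor (he l i).1, htail, ← neg_mul]
    congr 1
    rw [walsh_two_pow, walsh_two_pow]
    have : flipG l (2 * MM i) g l (2 * MM i) = g l (2 * MM i) + 1 := by simp [flipG]
    rw [this]
    rcases zmod2_cases (g l (2 * MM i)) with h | h <;> rw [h]
    · simp
    · simp [show (1 + 1 : ZMod 2) = 0 by decide]
  · apply Finset.prod_congr rfl
    intro l' hl'
    have : l' ≠ l := (Finset.mem_erase.mp hl').1
    simp [flipG, this]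

/-- Successive corrections of a point. -/
def Gseq {d : ℕ} (e : Fin d → ℕ → ℕ → ℕ) (l : Fin d) (g : GD d) : ℕ → GD d
  | 0 => g
  | s + 1 => if Rd e s (Gseq e l g s) = 1 then Gseq e l g s
      else flipG l (2 * MM s) (Gseq e l g s)

lemma extend {d : ℕ} (hd : 0 < d) {e : Fin d → ℕ → ℕ → ℕ} (he : ∀ l, Adm (e l)) (g : GD d)
    (K : ℕ) (hK : ∀ i, 2 * MM i + 1 ≤ K → Rd e i g = 1) :
    ∃ g' : GD d, (∀ l, ∀ t < K, g' l t = g l t) ∧ ∀ i, Rd e i g' = 1 := by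
  set l0 : Fin d := ⟨0, hd⟩
  set G := Gseq e l0 g with hG
  have hGs : ∀ s, G (s + 1) = if Rd e s (G s) = 1 then G s else flipG l0 (2 * MM s) (G s) :=
    fun s => rfl
  have hone : ∀ s, Rd e s (G (s + 1)) = 1 := by
    intro s
    rw [hGs]
    split_ifs with h
    · exact h
    · rw [Rd_flip he, (Rd_cases e s (G s)).resolve_left h, neg_neg]
  have hstep : ∀ s l t, t < 2 * MM s → G (s + 1) l t = G s l t := by
    intro s l t ht
    rw [hGs]
    split_ifs
    · rfl
    · exact flipG_ne _ _ _ _ (by omega)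
  have hmono : ∀ u v, u ≤ v → ∀ l t, t < 2 * MM u → G v l t = G u l t := by
    intro u v huv l t ht
    induction v, huv using Nat.le_induction with
    | base => rfl
    | succ v hv ih =>
      have := MM_mono hv
      rw [hstep v l t (by omega), ih]
  have hKs : ∀ s l, ∀ t < K, G s l t = g l t := by
    intro s
    induction s with
    | zero => intro l t _; rfl
    | succ s ih =>
      intro l t ht
      rw [hGs]
      split_ifs with h
      · exact ih l t ht
      · rw [flipG_ne, ih l t ht]
        intro htk
        apply h
        rw [← hK s (by omega)]
        exact Rd_dep he fun l' t' ht' => ih l' t' (by omega)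
  refine ⟨fun l t => G (t + 1) l t, fun l t ht => hKs _ l t ht, fun i => ?_⟩
  rw [← hone i]
  apply Rd_dep he
  intro l t ht
  rcases le_total (t + 1) (i + 1) with h | h
  · have := MM_ge (t + 1)
    exact (hmono _ _ h l t (by omega)).symm
  · have := MM_step (Nat.lt_succ_self i)
    exact hmono _ _ h l t (by
      have h3 : 2 * MM i + 1 ≤ MM (i + 1) := this
      omega)

lemma mem_cube_agree {d k : ℕ} {m : Fin d → ℕ} {x : GD d} (h : x ∈ dyadicCube k m) :
    ∀ l, ∀ t < k, x l t = cubePoint k m l t := fun l => mem_interval_agree (h l)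

lemma mem_cube_of_agree {d k : ℕ} {m : Fin d → ℕ} {x y : GD d} (h : y ∈ dyadicCube k m)
    (hxy : ∀ l, ∀ t < k, x l t = y l t) : x ∈ dyadicCube k m := by
  intro l t ht
  rw [hxy l t ht]
  exact h l t ht

lemma cubePoint_mem {d : ℕ} (k : ℕ) (m : Fin d → ℕ) : cubePoint k m ∈ dyadicCube k m :=
  fun l => pt_mem k (m l)

lemma cube_meets {d : ℕ} (hd : 0 < d) {e : Fin d → ℕ → ℕ → ℕ} (he : ∀ l, Adm (e l))
    {F : Set (GD d)} (hF : ∀ g, g ∈ F ↔ ∀ s, Rd e s g = 1) (k : ℕ) (m : Fin d → ℕ) :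
    (dyadicCube k m ∩ F).Nonempty ↔ ∀ i, 2 * MM i + 1 ≤ k → Rd e i (cubePoint k m) = 1 := by
  constructor
  · rintro ⟨x, hx, hxF⟩ i hi
    rw [← (hF x).mp hxF i]
    exact Rd_dep he fun l t ht => (mem_cube_agree hx l t (by omega)).symm
  · intro h
    obtain ⟨g', h1, h2⟩ := extend hd he (cubePoint k m) k h
    exact ⟨g', mem_cube_of_agree (cubePoint_mem k m) h1, (hF g').mpr h2⟩


/-! ### The canonical quasimeasure -/

/-- The layers which are determined at rank `k`. -/
def lay (k : ℕ) : Finset ℕ := (Finset.range k).filter fun i => 2 * MM i + 1 ≤ k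

lemma mem_lay {k i : ℕ} : i ∈ lay k ↔ 2 * MM i + 1 ≤ k := by
  unfold lay
  rw [Finset.mem_filter, Finset.mem_range]
  have := MM_ge i
  constructor
  · exact fun h => h.2
  · intro h; exact ⟨by omega, h⟩

lemma lay_two_MM (L : ℕ) : lay (2 * MM L) = Finset.range L := by
  ext i
  rw [mem_lay, Finset.mem_range]
  constructor
  · intro h
    by_contra hle
    have := MM_mono (show L ≤ i by omega)
    omega
  · intro h
    have := MM_step h
    omega

lemma MM_inj {i j : ℕ} (h : MM i = MM j) : i = j := by
  rcases lt_trichotomy i j with h1 | h1 | h1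
  · have := MM_step h1; omega
  · exact h1
  · have := MM_step h1; omega

lemma child_idx {k m b : ℕ} (hm : m < 2 ^ k) (hb : b < 2) :
    (∀ t < k, intervalPoint (k + 1) (2 * m + b) t = intervalPoint k m t) ∧
    (intervalPoint (k + 1) (2 * m + b) k = 1 ↔ b = 1) := by
  have h1 : idx (k + 1) (intervalPoint (k + 1) (2 * m + b)) = 2 * m + b :=
    idx_pt (by rw [pow_succ]; omega)
  rw [idx] at h1
  rw [agree_iff, idx_pt hm]
  split_ifs at h1 with h
  · exact ⟨by omega, by simp only [h, true_iff]; omega⟩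
  · exact ⟨by omega, by simp only [h, false_iff]; omega⟩

lemma sum_prod_two {d : ℕ} (f : Fin d → Fin 2 → ℝ) :
    ∑ σ : Fin d → Fin 2, ∏ l, f l (σ l) = ∏ l, ∑ b, f l b := by
  rw [Finset.prod_univ_sum]
  apply Finset.sum_congr _ fun _ _ => rfl
  ext σ
  simp

lemma sum_child {d : ℕ} (hd : 0 < d) {e : Fin d → ℕ → ℕ → ℕ} (he : ∀ l, Adm (e l)) (s : ℕ)
    {m : Fin d → ℕ} (hm : ∀ l, m l < 2 ^ (2 * MM s)) :
    ∑ σ : Fin d → Fin 2, Rd e s (cubePoint (2 * MM s + 1) fun l => 2 * m l + (σ l : ℕ)) = 0 := by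
  have hφ : ∃ φ : Fin d → Fin 2 → ℝ, ∀ l b, φ l b = (if b = 1 then (-1 : ℝ) else 1) *
        walsh (2 ^ MM s * e l s (idx (MM s) (intervalPoint (2 * MM s) (m l))))
          (intervalPoint (2 * MM s) (m l)) := ⟨_, fun _ _ => rfl⟩
  obtain ⟨φ, hφ⟩ := hφ
  have h1 : ∀ σ : Fin d → Fin 2,
      Rd e s (cubePoint (2 * MM s + 1) fun l => 2 * m l + (σ l : ℕ)) = ∏ l, φ l (σ l) := by
    intro σ
    unfold Rd
    apply Finset.prod_congr rfl
    intro l _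
    obtain ⟨c1, c2⟩ := child_idx (hm l) (σ l).isLt
    have htail := Rw_tail_dep (he l s).1 _ _ c1
    simp only at htail
    simp only [cubePoint]
    rw [hφ, Rw_factor (he l s).1, htail, walsh_two_pow]
    congr 1
    have : (σ l = 1) ↔ ((σ l : ℕ) = 1) := by
      constructor
      · intro h; rw [h]; rfl
      · intro h; ext; exact h
    by_cases h : σ l = 1
    · rw [if_pos h, if_pos (c2.mpr (this.mp h))]
    · rw [if_neg h, if_neg (fun h' => h (this.mpr (c2.mp h')))]
  refine (Finset.sum_congr rfl (fun σ _ => h1 σ)).trans ((sum_prod_two _).trans ?_)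
  apply Finset.prod_eq_zero (Finset.mem_univ (⟨0, hd⟩ : Fin d))
  rw [Fin.sum_univ_two, hφ, hφ]
  simp

/-- The explicit mass. -/
def mass {d : ℕ} (e : Fin d → ℕ → ℕ → ℕ) (k : ℕ) (m : Fin d → ℕ) : ℝ :=
  ((2 : ℝ) ^ (k * d))⁻¹ * ∏ i ∈ lay k, (1 + Rd e i (cubePoint k m))

lemma mass_one {d : ℕ} {e : Fin d → ℕ → ℕ → ℕ} {k : ℕ} {m : Fin d → ℕ}
    (h : ∀ i, 2 * MM i + 1 ≤ k → Rd e i (cubePoint k m) = 1) :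
    mass e k m = ((2 : ℝ) ^ (k * d))⁻¹ * 2 ^ (lay k).card := by
  unfold mass
  congr 1
  rw [Finset.prod_congr rfl (g := fun _ => (2 : ℝ)), Finset.prod_const]
  intro i hi
  rw [h i (mem_lay.mp hi)]
  norm_num

lemma mass_zero {d : ℕ} {e : Fin d → ℕ → ℕ → ℕ} {k : ℕ} {m : Fin d → ℕ}
    (h : ¬ ∀ i, 2 * MM i + 1 ≤ k → Rd e i (cubePoint k m) = 1) : mass e k m = 0 := by
  push Not at h
  obtain ⟨i, hi, hne⟩ := h
  unfold mass
  rw [Finset.prod_eq_zero (mem_lay.mpr hi), mul_zero]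
  rw [(Rd_cases e i _).resolve_left hne]
  norm_num

lemma count_children {d : ℕ} (hd : 0 < d) {e : Fin d → ℕ → ℕ → ℕ} (he : ∀ l, Adm (e l))
    {k : ℕ} {m : Fin d → ℕ} (hm : ∀ l, m l < 2 ^ k)
    (hk : ∀ i, 2 * MM i + 1 ≤ k → Rd e i (cubePoint k m) = 1) (C : Finset (Fin d → Fin 2))
    (hC : ∀ σ, σ ∈ C ↔ ∀ i, 2 * MM i + 1 ≤ k + 1 →
      Rd e i (cubePoint (k + 1) fun l => 2 * m l + (σ l : ℕ)) = 1) :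
    (C.card : ℝ) * 2 ^ (lay (k + 1)).card = 2 ^ d * 2 ^ (lay k).card := by
  have hold : ∀ (σ : Fin d → Fin 2) i, 2 * MM i + 1 ≤ k →
      Rd e i (cubePoint (k + 1) fun l => 2 * m l + (σ l : ℕ)) = 1 := by
    intro σ i hi
    rw [← hk i hi]
    apply Rd_dep he
    intro l t ht
    exact (child_idx (hm l) (σ l).isLt).1 t (by omega)
  by_cases hs : ∃ s, k = 2 * MM s
  · obtain ⟨s, rfl⟩ := hs
    have hlay : lay (2 * MM s + 1) = insert s (lay (2 * MM s)) := by
      ext i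
      rw [Finset.mem_insert, mem_lay, mem_lay]
      constructor
      · intro h
        by_cases h' : MM i = MM s
        · exact Or.inl (MM_inj h')
        · right; omega
      · rintro (rfl | h)
        · exact le_rfl
        · omega
    have hns : s ∉ lay (2 * MM s) := by rw [mem_lay]; omega
    rw [hlay, Finset.card_insert_of_notMem hns]
    have hsum : ∑ σ : Fin d → Fin 2,
        (1 + Rd e s (cubePoint (2 * MM s + 1) fun l => 2 * m l + (σ l : ℕ))) = 2 ^ d := by
      rw [Finset.sum_add_distrib, sum_child hd he s hm]
      simp
    have hsum2 : ∑ σ : Fin d → Fin 2,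
        (1 + Rd e s (cubePoint (2 * MM s + 1) fun l => 2 * m l + (σ l : ℕ))) = C.card * 2 := by
      have : ∀ σ : Fin d → Fin 2,
          (1 + Rd e s (cubePoint (2 * MM s + 1) fun l => 2 * m l + (σ l : ℕ))) =
          if σ ∈ C then (2 : ℝ) else 0 := by
        intro σ
        split_ifs with h
        · rw [(hC σ).mp h s le_rfl]; norm_num
        · have : Rd e s (cubePoint (2 * MM s + 1) fun l => 2 * m l + (σ l : ℕ)) ≠ 1 := by
            intro h1
            apply h
            rw [hC]
            intro i hi
            by_cases h' : MM i = MM s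
            · rw [MM_inj h', h1]
            · exact hold σ i (by omega)
          rw [(Rd_cases e s _).resolve_left this]; norm_num
      simp only [this]
      rw [Finset.sum_ite_mem, Finset.univ_inter, Finset.sum_const, nsmul_eq_mul]
    rw [pow_succ, ← hsum, hsum2]
    ring
  · have hlay : lay (k + 1) = lay k := by
      ext i
      rw [mem_lay, mem_lay]
      constructor
      · intro h
        by_contra h'
        exact hs ⟨i, by omega⟩
      · intro h; omega
    have hCu : C = Finset.univ := by
      rw [Finset.eq_univ_iff_forall]
      intro σ
      rw [hC]
      intro i hi
      apply hold
      rw [← mem_lay, hlay] at hi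
      exact mem_lay.mp hi
    rw [hlay, hCu, Finset.card_univ]
    simp

lemma tau_eq_mass {d : ℕ} (hd : 0 < d) {e : Fin d → ℕ → ℕ → ℕ} (he : ∀ l, Adm (e l))
    {F : Set (GD d)} (hF : ∀ g, g ∈ F ↔ ∀ s, Rd e s g = 1) {τ : ℕ → (Fin d → ℕ) → ℂ}
    (hτ : IsTauOf F τ) (k : ℕ) : ∀ m : Fin d → ℕ, (∀ l, m l < 2 ^ k) →
      τ k m = (mass e k m : ℝ) := by
  obtain ⟨_, h0, hz, hdiv⟩ := hτ
  induction k with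
  | zero =>
    intro m hm
    have : m = fun _ => 0 := by
      funext l
      have := hm l
      simp at this
      exact this
    rw [this, h0, mass_one (by intro i hi; omega)]
    have : lay 0 = ∅ := by simp [lay]
    simp [this]
  | succ k ih =>
    intro m' hm'
    by_cases hP : (dyadicCube (k + 1) m' ∩ F).Nonempty
    · obtain ⟨m, σ, hm, rfl⟩ : ∃ (m : Fin d → ℕ) (σ : Fin d → Fin 2), (∀ l, m l < 2 ^ k) ∧
          m' = fun l => 2 * m l + (σ l : ℕ) := by
        refine ⟨fun l => m' l / 2, fun l => ⟨m' l % 2, Nat.mod_lt _ (by norm_num)⟩, ?_, ?_⟩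
        · intro l
          have := hm' l
          rw [pow_succ] at this
          simp only
          omega
        · funext l
          simp only
          omega
      have hPk : (dyadicCube k m ∩ F).Nonempty := by
        obtain ⟨x, hx, hxF⟩ := hP
        refine ⟨x, ?_, hxF⟩
        apply mem_cube_of_agree (cubePoint_mem k m)
        intro l t ht
        rw [mem_cube_agree hx l t (by omega)]
        exact (child_idx (hm l) (σ l).isLt).1 t ht
      have h1 := hdiv k m hm hPk σ
      rw [if_pos hP, ih m hm] at h1
      rw [h1]
      have hk := (cube_meets hd he hF k m).mp hPk
      have hcount := count_children hd he hm hk (Finset.univ.filter fun σ' : Fin d → Fin 2 =>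
              (dyadicCube (k + 1) (fun l => 2 * m l + (σ' l : ℕ)) ∩ F).Nonempty) (by
        intro σ'
        rw [Finset.mem_filter, cube_meets hd he hF]
        simp)
      rw [mass_one hk, mass_one ((cube_meets hd he hF _ _).mp hP)]
      generalize (Finset.univ.filter fun σ' : Fin d → Fin 2 =>
              (dyadicCube (k + 1) (fun l => 2 * m l + (σ' l : ℕ)) ∩ F).Nonempty).card = c
        at hcount ⊢
      have hc : (c : ℝ) ≠ 0 := by
        intro h
        rw [h, zero_mul] at hcount
        have : (0 : ℝ) < 2 ^ d * 2 ^ (lay k).card := by positivity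
        linarith
      rw [← Complex.ofReal_natCast, ← Complex.ofReal_div]
      congr 1
      rw [add_mul, one_mul, pow_add, div_eq_iff hc]
      have e1 : (2 : ℝ) ^ (k * d) ≠ 0 := by positivity
      have e2 : (2 : ℝ) ^ d ≠ 0 := by positivity
      rw [mul_inv]
      calc ((2 : ℝ) ^ (k * d))⁻¹ * 2 ^ (lay k).card
          = ((2 : ℝ) ^ (k * d))⁻¹ * ((2 : ℝ) ^ d)⁻¹ * (2 ^ d * 2 ^ (lay k).card) := by
            field_simp
        _ = _ := by rw [← hcount]; ring
    · rw [(hz (k + 1) m' hm').mpr (Set.not_nonempty_iff_eq_empty.mp hP),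
        mass_zero (fun h => hP ((cube_meets hd he hF _ _).mpr h))]
      simp

lemma restrict_eq {d : ℕ} (τ : ℕ → (Fin d → ℕ) → ℂ) {r k : ℕ} (hrk : r ≤ k)
    (c m : Fin d → ℕ) : restrictQM τ r c k m =
      if cubePoint k m ∈ dyadicCube r c then τ k m else 0 := by
  unfold restrictQM
  by_cases h : cubePoint k m ∈ dyadicCube r c
  · have hsub : dyadicCube k m ⊆ dyadicCube r c := by
      intro x hx
      exact mem_cube_of_agree h fun l t ht => mem_cube_agree hx l t (by omega)
    rw [if_pos hsub, if_pos h]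
  · have hsub : ¬ dyadicCube k m ⊆ dyadicCube r c := fun hs => h (hs (cubePoint_mem k m))
    have hsub2 : ¬ dyadicCube r c ⊆ dyadicCube k m := by
      intro hs
      apply h
      have h1 := mem_cube_agree (hs (cubePoint_mem r c))
      exact mem_cube_of_agree (cubePoint_mem r c) fun l t ht => (h1 l t (by omega)).symm
    rw [if_neg hsub, if_neg hsub2, if_neg h]

lemma hasCoef_of_tau {d : ℕ} (hd : 0 < d) {e : Fin d → ℕ → ℕ → ℕ} (he : ∀ l, Adm (e l))
    {F : Set (GD d)} (hF : ∀ g, g ∈ F ↔ ∀ s, Rd e s g = 1) {τ : ℕ → (Fin d → ℕ) → ℂ}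
    (hτ : IsTauOf F τ) {r : ℕ} {c : Fin d → ℕ} {a : (Fin d → ℕ) → ℂ}
    (ha : ∀ (n : Fin d → ℕ) (k : ℕ), (∀ l, n l < 2 ^ k) →
      a n = fourierCoeffAt (restrictQM τ r c) n k) : HasCoef r c e a := by
  intro n L hr hn
  rw [ha n (2 * MM L) hn, coef_eq_dens]
  unfold fourierCoeffAt
  rw [Complex.ofReal_sum]
  apply Finset.sum_congr rfl
  intro m hm
  have hm' : ∀ l, m l < 2 ^ (2 * MM L) := fun l =>
    Finset.mem_range.mp (Fintype.mem_piFinset.mp hm l)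
  rw [restrict_eq τ hr, tau_eq_mass hd he hF hτ _ m hm', mass, densF, lay_two_MM]
  split_ifs <;> simp

lemma coef_ne_zero {d : ℕ} {e : Fin d → ℕ → ℕ → ℕ} (he : ∀ l, Adm (e l))
    {r : ℕ} {c : Fin d → ℕ} {a : (Fin d → ℕ) → ℂ} (ha : HasCoef r c e a) {x : GD d}
    (hx : x ∈ dyadicCube r c) (hxF : ∀ s, Rd e s x = 1) : ∃ n, a n ≠ 0 := by
  refine ⟨fun _ => 0, ?_⟩
  have hr : r ≤ 2 * MM r := by have := MM_ge r; omega
  rw [ha (fun _ => 0) r hr (fun _ => by positivity), coef_eq_dens]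
  rw [Complex.ofReal_ne_zero]
  apply ne_of_gt
  have hw : ∀ m : Fin d → ℕ, walshValD (2 * MM r) (fun _ => 0) m = 1 := by
    intro m
    simp [walshValD, walshD, walsh_zero]
  apply Finset.sum_pos'
  · intro m _
    rw [hw, one_mul]
    apply mul_nonneg (by positivity)
    unfold densF
    apply mul_nonneg
    · split_ifs <;> norm_num
    · apply Finset.prod_nonneg
      intro i _
      rcases Rd_cases e i (cubePoint (2 * MM r) m) with h | h <;> rw [h] <;> norm_num
  · refine ⟨fun l => idx (2 * MM r) (x l), ?_, ?_⟩
    · unfold boxLt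
      rw [Fintype.mem_piFinset]
      intro l
      rw [Finset.mem_range]
      exact idx_lt _ _
    · rw [hw, one_mul]
      apply mul_pos (by positivity)
      have hag : ∀ l, ∀ t < 2 * MM r,
          cubePoint (2 * MM r) (fun l => idx (2 * MM r) (x l)) l t = x l t :=
        fun l => pt_idx_agree _ _
      unfold densF
      rw [if_pos (mem_cube_of_agree hx fun l t ht => hag l t (by omega)), one_mul]
      apply Finset.prod_pos
      intro i hi
      have hir := MM_step (Finset.mem_range.mp hi)
      rw [Rd_dep he (g' := x) (fun l t ht => hag l t (by omega)), hxF]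
      norm_num

lemma open_cyl {d : ℕ} {G : Set (GD d)} (hG : IsOpen G) {x : GD d} (hx : x ∈ G) :
    ∃ k : ℕ, ∀ y : GD d, (∀ l, ∀ t < k, y l t = x l t) → y ∈ G := by
  by_contra hcon
  push Not at hcon
  choose y hy hyG using hcon
  have hlim : Tendsto y atTop (𝓝 x) := by
    rw [tendsto_pi_nhds]
    intro l
    rw [tendsto_pi_nhds]
    intro t
    apply tendsto_atTop_of_eventually_const (i₀ := t + 1)
    intro k hk
    exact hy k l t (by omega)
  obtain ⟨k, hk⟩ := (hlim.eventually (hG.mem_nhds hx)).exists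
  exact hyG k hk

/-- for `π ∈ S'` and open `G` with `G ∩ F^π ≠ ∅`, the set `G ∩ F^π` is an
M-set (rectangular, cube and iterated convergence); moreover there is a dyadic cube
`Δ* ⊆ G` of rank `m_{s₀}` meeting `F^π` such that the Walsh series of the restricted
quasimeasure `τ_{F^π}|_{Δ*}` is a non-trivial series converging to 0 over rectangles
outside `G ∩ F^π`. -/
theorem statement19 (d : ℕ) (hd : 2 ≤ d) (π : PermSeq d) (hπ : π.Coordinatewise)
    (G : Set (GD d)) (hG : IsOpen G) (hne : (G ∩ Fpi π.f).Nonempty) :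
    IsMSetRect (G ∩ Fpi π.f) ∧ IsMSetCubes (G ∩ Fpi π.f) ∧
    (∀ l : List (Fin d), l.Nodup → (∀ j, j ∈ l) → IsMSetIter (G ∩ Fpi π.f) l) ∧
    ∃ (s₀ : ℕ) (mΔ : Fin d → ℕ), 1 ≤ s₀ ∧ (∀ l, mΔ l < 2 ^ mSeq s₀) ∧
      dyadicCube (mSeq s₀) mΔ ⊆ G ∧
      (dyadicCube (mSeq s₀) mΔ ∩ Fpi π.f).Nonempty ∧
      ∀ τ : ℕ → (Fin d → ℕ) → ℂ, IsTauOf (Fpi π.f) τ →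
        ∀ a : (Fin d → ℕ) → ℂ,
          (∀ (n : Fin d → ℕ) (k : ℕ), (∀ l, n l < 2 ^ k) →
            a n = fourierCoeffAt (restrictQM τ (mSeq s₀) mΔ) n k) →
          (∃ n, a n ≠ 0) ∧ ∀ g ∉ G ∩ Fpi π.f, ConvergesOverRectangles a g 0 := by
  have hd0 : 0 < d := by omega
  obtain ⟨e, he, hF⟩ := exists_adm π hπ
  obtain ⟨x, hxG, hxF⟩ := hne
  obtain ⟨k, hk⟩ := open_cyl hG hxG
  have hkM := MM_ge k
  set c : Fin d → ℕ := fun l => idx (MM k) (x l) with hc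
  have hxc : x ∈ dyadicCube (MM k) c := fun l => mem_interval_idx _ _
  have hsub : dyadicCube (MM k) c ⊆ G := by
    intro y hy
    apply hk
    intro l t ht
    rw [mem_cube_agree hy l t (by omega), mem_cube_agree hxc l t (by omega)]
  have hxR := (hF x).mp hxF
  have hout : ∀ g ∉ G ∩ Fpi π.f, g ∉ dyadicCube (MM k) c ∨ ∃ i, Rd e i g ≠ 1 := by
    intro g hg
    by_cases h : g ∈ dyadicCube (MM k) c
    · right
      by_contra hcon
      push Not at hcon
      exact hg ⟨hsub h, (hF g).mpr hcon⟩
    · exact Or.inl h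
  obtain ⟨a, ha⟩ := exists_hasCoef hd0 (MM k) c he
  have hne0 := coef_ne_zero he ha hxc hxR
  have hconv : ∀ g ∉ G ∩ Fpi π.f, ConvergesOverRectangles a g 0 :=
    fun g hg => main_conv hd0 he ha g (hout g hg)
  refine ⟨⟨a, hne0, hconv⟩, ⟨a, hne0, fun g hg => ?_⟩, fun l hl hfull => ⟨a, hne0, fun g hg =>
    iter_of_rect hd0 he ha g (hconv g hg) l hl hfull⟩, k + 1, c, by omega, fun l => idx_lt _ _,
    hsub, ⟨x, hxc, hxF⟩, fun τ hτ b hb => ?_⟩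
  · have h1 := hconv g hg
    unfold ConvergesOverRectangles at h1
    refine h1.comp ?_
    rw [tendsto_atTop_atTop]
    intro N
    refine ⟨∑ i, N i, fun n hn i => ?_⟩
    exact (Finset.single_le_sum (f := N) (fun _ _ => Nat.zero_le _) (Finset.mem_univ i)).trans hn
  · have hb' : HasCoef (MM k) c e b := hasCoef_of_tau hd0 he hF hτ hb
    exact ⟨coef_ne_zero he hb' hxc hxR, fun g hg => main_conv hd0 he hb' g (hout g hg)⟩
end
end
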